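/- arXiv:2208.05904 — 13 statements merged into one kernel-verified Lean document; each statement's English description precedes it below -/
import Mathlib

section
/- Let x be a bounded real sequence and s ∈ ℝ. The following are equivalent: (i) L(x) = s for every Banach limit L; (ii) lim_{n→∞} (x_j + x_{j+1} + ⋯ + x_{j+n-1})/n = s uniformly with respect to j ∈ ℕ. -/
open Filter
open scoped ENNReal

noncomputable section

/-- `ℓ∞`: the Banach space of bounded real sequences with the supremum norm. -/
abbrev LInf : Type := lp (fun _ : ℕ => ℝ) ∞

/-- A Banach limit: a linear functional `L : ℓ∞ → ℝ` which is positive, shift-invariant,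
and sends the constant sequence `(1,1,…)` to `1`. -/
def IsBanachLimit (L : LInf →ₗ[ℝ] ℝ) : Prop :=
  (∀ x : LInf, (∀ n : ℕ, 0 ≤ x n) → 0 ≤ L x) ∧
  (∀ x y : LInf, (∀ n : ℕ, y n = x (n + 1)) → L y = L x) ∧
  L 1 = 1

theorem lor_bound (y : LInf) (n : ℕ) : |y n| ≤ ‖y‖ := lp.norm_apply_le_norm (by simp) y n

def lorMean (y : LInf) (n j : ℕ) : ℝ := (∑ i ∈ Finset.range n, y (j + i)) / n

theorem lorMean_bound (y : LInf) (n j : ℕ) : lorMean y n j ∈ Set.Icc (-‖y‖) ‖y‖ := by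
  rw [Set.mem_Icc, ← abs_le, lorMean, abs_div, Nat.abs_cast]
  apply div_le_of_le_mul₀ (Nat.cast_nonneg n) (norm_nonneg y)
  calc |∑ i ∈ Finset.range n, y (j + i)| ≤ ∑ i ∈ Finset.range n, |y (j + i)| :=
        Finset.abs_sum_le_sum_abs _ _
    _ ≤ ∑ i ∈ Finset.range n, ‖y‖ := Finset.sum_le_sum fun i _ => lor_bound y _
    _ = ‖y‖ * n := by simp [mul_comm]

theorem lor_exists (U : Ultrafilter ℕ) (hU : (U : Filter ℕ) ≤ atTop) (J : ℕ → ℕ) :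
    ∃ L : LInf →ₗ[ℝ] ℝ, IsBanachLimit L ∧
      ∀ y, Tendsto (fun n => lorMean y n (J n)) U (nhds (L y)) := by
  have h : ∀ y : LInf, ∃ l : ℝ, Tendsto (fun n => lorMean y n (J n)) U (nhds l) := by
    intro y
    obtain ⟨l, -, hl⟩ := (isCompact_Icc (a := -‖y‖) (b := ‖y‖)).ultrafilter_le_nhds
      (U.map (fun n => lorMean y n (J n)))
      (by
        rw [le_principal_iff]
        exact Ultrafilter.mem_map.2 (Filter.univ_mem' fun n => lorMean_bound y n (J n)))
    exact ⟨l, hl⟩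
  choose f hf using h
  refine ⟨⟨⟨f, ?_⟩, ?_⟩, ⟨?_, ?_, ?_⟩, hf⟩
  · intro y z
    refine tendsto_nhds_unique (hf _) (((hf y).add (hf z)).congr fun n => ?_)
    simp [lorMean, Finset.sum_add_distrib, add_div]
  · intro c y
    refine tendsto_nhds_unique (hf _) (((hf y).const_mul c).congr fun n => ?_)
    simp [lorMean, ← Finset.mul_sum, mul_div_assoc]
  · intro y hy
    refine ge_of_tendsto' (hf y) fun n => ?_
    exact div_nonneg (Finset.sum_nonneg fun i _ => hy _) (Nat.cast_nonneg n)
  · intro y z hz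
    change f z = f y
    have h0 : Tendsto (fun n : ℕ => (2 * ‖y‖) / (n : ℝ)) U (nhds 0) :=
      (tendsto_const_div_atTop_nhds_zero_nat _).mono_left hU
    have h1 : Tendsto (fun n => lorMean z n (J n) - lorMean y n (J n)) U (nhds 0) := by
      refine squeeze_zero_norm (fun n => ?_) h0
      have e : lorMean z n (J n) - lorMean y n (J n) = (y (J n + n) - y (J n)) / n := by
        rw [lorMean, lorMean, ← sub_div, ← Finset.sum_sub_distrib]
        congr 1
        have := Finset.sum_range_sub (fun i => y (J n + i)) n
        simp only [add_zero] at this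
        rw [← this]
        exact Finset.sum_congr rfl fun i _ => by rw [hz]; rfl
      rw [e, Real.norm_eq_abs, abs_div, Nat.abs_cast]
      gcongr
      have a1 := abs_le.1 (lor_bound y (J n + n))
      have a2 := abs_le.1 (lor_bound y (J n))
      rw [abs_le]
      constructor <;> linarith [a1.1, a1.2, a2.1, a2.2]
    have := tendsto_nhds_unique h1 ((hf z).sub (hf y))
    linarith
  · refine tendsto_nhds_unique (hf 1) (tendsto_const_nhds.congr' ?_)
    filter_upwards [hU (eventually_gt_atTop 0)] with n hn
    have : (n : ℝ) ≠ 0 := by exact_mod_cast (show 0 < n from hn).ne'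
    simp [lorMean, this]

def lorShift (x : LInf) (k : ℕ) : LInf :=
  ⟨fun n => x (n + k), memℓp_infty ⟨‖x‖, by rintro _ ⟨n, rfl⟩; exact lor_bound x _⟩⟩

theorem lor_L_shift {L : LInf →ₗ[ℝ] ℝ} (hL : IsBanachLimit L) (x : LInf) (k : ℕ) :
    L (lorShift x k) = L x := by
  induction k with
  | zero => rfl
  | succ k ih =>
    rw [← ih]
    refine hL.2.1 _ _ fun n => ?_
    change x (n + (k + 1)) = x (n + 1 + k)
    rw [show n + (k + 1) = n + 1 + k by omega]

theorem lor_mono {L : LInf →ₗ[ℝ] ℝ} (hL : IsBanachLimit L) (y z : LInf)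
    (h : ∀ n, y n ≤ z n) : L y ≤ L z := by
  have := hL.1 (z - y) fun n => by
    have := h n
    simpa using this
  rw [map_sub] at this
  linarith

/-- Lorentz's theorem: `L x = s` for every Banach limit `L` iff the window means
`(x_j + ⋯ + x_{j+n-1})/n` tend to `s` uniformly in `j`. -/
theorem stmt0 (x : LInf) (s : ℝ) :
    (∀ L : LInf →ₗ[ℝ] ℝ, IsBanachLimit L → L x = s) ↔
      TendstoUniformly (fun (n : ℕ) (j : ℕ) => (∑ i ∈ Finset.range n, x (j + i)) / n)
        (fun _ => s) atTop := by
  constructor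
  · intro h
    by_contra hn
    rw [Metric.tendstoUniformly_iff] at hn
    push Not at hn
    obtain ⟨ε, hε, hn⟩ := hn
    have hfr : ∃ᶠ n : ℕ in atTop, ∃ j : ℕ, ε ≤ dist s (lorMean x n j) := hn
    have : (atTop ⊓ Filter.principal {n : ℕ | ∃ j : ℕ, ε ≤ dist s (lorMean x n j)}).NeBot :=
      frequently_mem_iff_neBot.1 hfr
    set U := Ultrafilter.of (atTop ⊓ Filter.principal {n : ℕ | ∃ j : ℕ, ε ≤ dist s (lorMean x n j)}) with hUdef
    have hU := Ultrafilter.of_le (atTop ⊓ Filter.principal {n : ℕ | ∃ j : ℕ, ε ≤ dist s (lorMean x n j)})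
    have hJ : ∀ n : ℕ, ∃ j : ℕ, (∃ j : ℕ, ε ≤ dist s (lorMean x n j)) →
        ε ≤ dist s (lorMean x n j) := by
      intro n
      by_cases hh : ∃ j : ℕ, ε ≤ dist s (lorMean x n j)
      · obtain ⟨j, hj⟩ := hh
        exact ⟨j, fun _ => hj⟩
      · exact ⟨0, fun h' => absurd h' hh⟩
    choose J hJ using hJ
    obtain ⟨L, hL, ht⟩ := lor_exists U (hU.trans inf_le_left) J
    have hx := ht x
    rw [h L hL] at hx
    have h1 : ∀ᶠ n in (U : Filter ℕ), ε ≤ dist s (lorMean x n (J n)) := by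
      filter_upwards [hU.trans inf_le_right (mem_principal_self _)] with n hn'
      exact hJ n hn'
    have h2 := hx.eventually (Metric.ball_mem_nhds s hε)
    obtain ⟨n, a, b⟩ := (h1.and h2).exists
    rw [dist_comm] at b
    linarith
  · intro h L hL
    rw [Metric.tendstoUniformly_iff] at h
    refine eq_of_forall_dist_le fun ε hε => ?_
    obtain ⟨n, hn, hn0⟩ := ((h ε hε).and (eventually_gt_atTop 0)).exists
    have hp : (0 : ℝ) < n := by exact_mod_cast hn0
    set A : LInf := ∑ k ∈ Finset.range n, lorShift x k with hA
    have hLA : L A = n * L x := by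
      simp [hA, map_sum, lor_L_shift hL]
    have hAj : ∀ j, A j = ∑ i ∈ Finset.range n, x (j + i) := by
      intro j
      rw [hA, lp.coeFn_sum, Finset.sum_apply]
      rfl
    have hc : ∀ c : ℝ, L (c • (1 : LInf)) = c := by
      intro c
      rw [map_smul, hL.2.2, smul_eq_mul, mul_one]
    have key : ∀ j, (s - ε) * n ≤ A j ∧ A j ≤ (s + ε) * n := by
      intro j
      have := hn j
      rw [Real.dist_eq, abs_lt] at this
      rw [hAj, ← le_div_iff₀ hp, ← div_le_iff₀ hp]
      constructor <;> linarith [this.1, this.2]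
    have l1 := lor_mono hL (((s - ε) * n) • (1 : LInf)) A fun j => by
      simpa using (key j).1
    have l2 := lor_mono hL A (((s + ε) * n) • (1 : LInf)) fun j => by
      simpa using (key j).2
    rw [hc, hLA, mul_comm] at l1
    rw [hc, hLA, mul_comm (s + ε)] at l2
    have l1' := le_of_mul_le_mul_left l1 hp
    have l2' := le_of_mul_le_mul_left l2 hp
    rw [Real.dist_eq, abs_le]
    constructor <;> linarith
end
end

section
/- If a bounded real sequence x is almost convergent to s ∈ ℝ, then lim_{n→∞} (x₁ + ⋯ + xₙ)/n exists and equals s, and every Banach limit L satisfies L(x) = s. In particular ĉ ⊆ S. -/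
open Filter
open scoped ENNReal

noncomputable section

/-- `x` is almost convergent to `s`: the window means `(x_j + ⋯ + x_{j+n-1})/n` tend to `s`
uniformly in `j`. -/
def AlmostConvTo (x : ℕ → ℝ) (s : ℝ) : Prop :=
  TendstoUniformly (fun (n : ℕ) (j : ℕ) => (∑ i ∈ Finset.range n, x (j + i)) / n)
    (fun _ => s) atTop

/-- Every iterated shift of a bounded sequence is a bounded sequence. -/
lemma exists_shift (x : LInf) (k : ℕ) : ∃ y : LInf, ∀ n, y n = x (n + k) := by
  have hm : Memℓp (fun n : ℕ => (x (n + k) : ℝ)) ∞ := by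
    apply memℓp_infty
    refine ⟨‖x‖, ?_⟩
    rintro _ ⟨n, rfl⟩
    exact lp.norm_apply_le_norm ENNReal.top_ne_zero x (n + k)
  exact ⟨⟨_, hm⟩, fun n => rfl⟩

/-- A Banach limit is invariant under iterated shifts. -/
lemma banach_shift (L : LInf →ₗ[ℝ] ℝ) (hL : IsBanachLimit L) (x : LInf) (k : ℕ) :
    ∀ y : LInf, (∀ n, y n = x (n + k)) → L y = L x := by
  induction k with
  | zero =>
    intro y hy
    have : y = x := by
      ext n
      simpa using hy n
    rw [this]
  | succ k ih =>
    intro y hy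
    obtain ⟨z, hz⟩ := exists_shift x k
    rw [← ih z hz]
    apply hL.2.1 z y
    intro n
    rw [hy, hz, show n + 1 + k = n + (k + 1) by omega]

/-- Sums of shifts: a bounded sequence of window sums whose Banach limit is `m * L x`. -/
lemma exists_window (L : LInf →ₗ[ℝ] ℝ) (hL : IsBanachLimit L) (x : LInf) (m : ℕ) :
    ∃ y : LInf, (∀ j, y j = ∑ i ∈ Finset.range m, x (j + i)) ∧ L y = m * L x := by
  induction m with
  | zero => exact ⟨0, fun j => by simp, by simp⟩
  | succ m ih =>
    obtain ⟨y, hy, hLy⟩ := ih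
    obtain ⟨z, hz⟩ := exists_shift x m
    refine ⟨y + z, fun j => ?_, ?_⟩
    · rw [Finset.sum_range_succ, ← hy, ← hz]
      rfl
    · rw [map_add, hLy, banach_shift L hL x m z hz]
      push_cast
      ring

/-- If a bounded sequence `x` is almost convergent to `s`, then its arithmetic means
converge to `s` (so `x ∈ S`, whence `ĉ ⊆ S`) and every Banach limit sends `x` to `s`. -/
theorem stmt2 (x : LInf) (s : ℝ) (h : AlmostConvTo (fun n => x n) s) :
    Tendsto (fun n : ℕ => (∑ i ∈ Finset.range n, x i) / n) atTop (nhds s) ∧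
    ∀ L : LInf →ₗ[ℝ] ℝ, IsBanachLimit L → L x = s := by
  refine ⟨?_, ?_⟩
  · simpa using h.tendsto_at 0
  · intro L hL
    refine eq_of_abs_sub_le_all fun ε hε => ?_
    obtain ⟨m, hm, hm1⟩ :=
      ((Metric.tendstoUniformly_iff.1 h ε hε).and (eventually_ge_atTop 1)).exists
    have hm0 : (0 : ℝ) < m := by exact_mod_cast hm1
    obtain ⟨y, hy, hLy⟩ := exists_window L hL x m
    have key : ∀ j, |y j / m - s| < ε := by
      intro j
      have := hm j
      rw [dist_comm, Real.dist_eq] at this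
      rw [hy]
      exact this
    have h1 := hL.1 ((m : ℝ)⁻¹ • y - (s - ε) • (1 : LInf)) (fun n => by
      have := (abs_lt.1 (key n)).1
      change 0 ≤ (m : ℝ)⁻¹ * y n - (s - ε) * 1
      rw [div_eq_inv_mul] at this
      linarith)
    have h2 := hL.1 ((s + ε) • (1 : LInf) - (m : ℝ)⁻¹ • y) (fun n => by
      have := (abs_lt.1 (key n)).2
      change 0 ≤ (s + ε) * 1 - (m : ℝ)⁻¹ * y n
      rw [div_eq_inv_mul] at this
      linarith)
    simp only [map_sub, map_smul, smul_eq_mul, hL.2.2, hLy,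
      inv_mul_cancel_left₀ hm0.ne'] at h1 h2
    rw [abs_le]
    constructor <;> linarith
end
end

section
/- There exists a bounded real sequence x taking only the values 0 and 1 such that lim_{n→∞} (x₁ + ⋯ + xₙ)/n = 1 but x is not almost convergent (the window means (x_j + ⋯ + x_{j+n-1})/n do not converge uniformly in j); consequently the inclusion ĉ ⊆ S is proper. -/
open Filter
open scoped ENNReal

noncomputable section

/-- Equals 0 on the zero blocks (from k² to k² + √k, exclusive) and 1 elsewhere. -/
def xseq (n : ℕ) : ℝ :=
  if n - Nat.sqrt n * Nat.sqrt n < Nat.sqrt (Nat.sqrt n) then 0 else 1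

lemma xseq_zero_one (n : ℕ) : xseq n = 0 ∨ xseq n = 1 := by
  unfold xseq
  split_ifs <;> simp

lemma xseq_window (n i : ℕ) (hi : i < n) : xseq ((n * n) * (n * n) + i) = 0 := by
  have h1 : Nat.sqrt ((n * n) * (n * n) + i) = n * n := by
    apply Nat.sqrt_add_eq
    nlinarith
  unfold xseq
  rw [h1, Nat.sqrt_eq]
  simp [hi]

lemma zero_count (n : ℕ) :
    ((Finset.range n).filter
      (fun i => i - Nat.sqrt i * Nat.sqrt i < Nat.sqrt (Nat.sqrt i))).card
      ≤ (Nat.sqrt n + 1) * Nat.sqrt (Nat.sqrt n) := by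
  have h := Finset.card_le_card_of_injOn
    (s := (Finset.range n).filter
      (fun i => i - Nat.sqrt i * Nat.sqrt i < Nat.sqrt (Nat.sqrt i)))
    (t := Finset.range (Nat.sqrt n + 1) ×ˢ Finset.range (Nat.sqrt (Nat.sqrt n)))
    (fun i => (Nat.sqrt i, i - Nat.sqrt i * Nat.sqrt i)) ?_ ?_
  · simpa using h
  · intro i hi
    simp only [Finset.coe_filter, Finset.mem_range, Set.mem_ofPred_eq] at hi
    have h1 : Nat.sqrt i ≤ Nat.sqrt n := Nat.sqrt_le_sqrt hi.1.le
    have h2 := Nat.sqrt_le_sqrt h1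
    simp only [Finset.coe_product, Set.mem_prod, Finset.mem_coe, Finset.mem_range]
    omega
  · intro a _ b _ hab
    simp only [Prod.mk.injEq] at hab
    have ha := Nat.sqrt_le a
    have hb := Nat.sqrt_le b
    obtain ⟨h1, h2⟩ := hab
    rw [h1] at h2 ha
    omega

lemma sum_xseq (n : ℕ) :
    (∑ i ∈ Finset.range n, xseq i) + ((Finset.range n).filter
      (fun i => i - Nat.sqrt i * Nat.sqrt i < Nat.sqrt (Nat.sqrt i))).card = n := by
  rw [Finset.card_filter]
  push_cast
  rw [← Finset.sum_add_distrib]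
  have : ∀ i ∈ Finset.range n, xseq i +
      (if i - Nat.sqrt i * Nat.sqrt i < Nat.sqrt (Nat.sqrt i) then (1 : ℝ) else 0) = 1 := by
    intro i _
    unfold xseq
    split_ifs <;> simp
  rw [Finset.sum_congr rfl this]
  simp

lemma xseq_mean :
    Tendsto (fun n : ℕ => (∑ i ∈ Finset.range n, xseq i) / n) atTop (nhds 1) := by
  have hs : Tendsto Nat.sqrt atTop atTop := by
    refine tendsto_atTop.2 fun b => ?_
    filter_upwards [eventually_ge_atTop (b * b)] with n hn
    exact Nat.le_sqrt.2 hn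
  have ht : Tendsto (fun n : ℕ => (1 : ℝ) - 2 / (Nat.sqrt (Nat.sqrt n) : ℝ)) atTop (nhds 1) := by
    have := (tendsto_const_div_atTop_nhds_zero_nat (2 : ℝ)).comp (hs.comp hs)
    simpa using this.const_sub 1
  refine tendsto_of_tendsto_of_tendsto_of_le_of_le' ht tendsto_const_nhds ?_ ?_
  · filter_upwards [eventually_ge_atTop 1] with n hn
    have hsum := sum_xseq n
    have hc : ((((Finset.range n).filter
      (fun i => i - Nat.sqrt i * Nat.sqrt i < Nat.sqrt (Nat.sqrt i))).card : ℕ) : ℝ)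
      ≤ (Nat.sqrt n + 1) * Nat.sqrt (Nat.sqrt n) := by exact_mod_cast zero_count n
    have h1 : (1 : ℝ) ≤ Nat.sqrt n := by exact_mod_cast Nat.le_sqrt.2 (by simpa using hn)
    have h2 : (1 : ℝ) ≤ Nat.sqrt (Nat.sqrt n) := by
      exact_mod_cast Nat.le_sqrt.2 (by simpa using (Nat.le_sqrt.2 (by simpa using hn) : 1 ≤ Nat.sqrt n))
    have h3 : (Nat.sqrt n : ℝ) * Nat.sqrt n ≤ n := by exact_mod_cast Nat.sqrt_le n
    have h4 : (Nat.sqrt (Nat.sqrt n) : ℝ) * Nat.sqrt (Nat.sqrt n) ≤ Nat.sqrt n := by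
      exact_mod_cast Nat.sqrt_le (Nat.sqrt n)
    have hn0 : (0 : ℝ) < n := by exact_mod_cast hn
    generalize (((Finset.range n).filter
      (fun i => i - Nat.sqrt i * Nat.sqrt i < Nat.sqrt (Nat.sqrt i))).card : ℝ) = c at *
    generalize (Nat.sqrt (Nat.sqrt n) : ℝ) = t at *
    generalize (Nat.sqrt n : ℝ) = s at *
    have ht0 : 0 < t := by linarith
    rw [le_div_iff₀ hn0]
    have h5 : c ≤ 2 / t * n := by
      rw [div_mul_eq_mul_div, le_div_iff₀ ht0]
      calc c * t ≤ (s + 1) * t * t := by gcongr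
        _ = (s + 1) * (t * t) := by ring
        _ ≤ (s + s) * s := by gcongr
        _ ≤ 2 * n := by linarith
    linarith
  · filter_upwards with n
    apply div_le_one_of_le₀ _ (Nat.cast_nonneg n)
    have hsum := sum_xseq n
    have := Nat.cast_nonneg (α := ℝ) (((Finset.range n).filter
      (fun i => i - Nat.sqrt i * Nat.sqrt i < Nat.sqrt (Nat.sqrt i))).card)
    linarith

/-- There is a 0-1 valued (hence bounded) sequence whose arithmetic means converge to `1`
but which is not almost convergent (to any `s`); hence the inclusion `ĉ ⊆ S` is proper. -/
theorem stmt3 :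
    ∃ x : ℕ → ℝ, (∀ n, x n = 0 ∨ x n = 1) ∧
      Tendsto (fun n : ℕ => (∑ i ∈ Finset.range n, x i) / n) atTop (nhds 1) ∧
      ∀ s : ℝ, ¬ AlmostConvTo x s := by
  refine ⟨xseq, xseq_zero_one, xseq_mean, ?_⟩
  intro s hs
  have h0 := hs.tendsto_at 0
  simp only [zero_add] at h0
  have hs1 : s = 1 := tendsto_nhds_unique h0 xseq_mean
  subst hs1
  obtain ⟨n, hn⟩ := (Metric.tendstoUniformly_iff.1 hs 1 one_pos).exists
  have h := hn ((n * n) * (n * n))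
  rw [Finset.sum_eq_zero (fun i hi => xseq_window n i (Finset.mem_range.1 hi))] at h
  simp at h
end
end

section
/- The set ĉ of almost convergent sequences and the set ĉ₀ of sequences almost convergent to 0 are closed subsets of ℓ∞ (with the supremum norm topology). -/
open Filter
open scoped ENNReal

noncomputable section

/-- The window means are 1-Lipschitz in the sequence. -/
theorem mean_dist_le (x y : LInf) (n j : ℕ) :
    dist ((∑ i ∈ Finset.range n, x (j + i)) / (n : ℝ))
      ((∑ i ∈ Finset.range n, y (j + i)) / (n : ℝ)) ≤ dist x y := by
  have hpt : ∀ m : ℕ, |x m - y m| ≤ dist x y := by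
    intro m
    have h := lp.norm_apply_le_norm ENNReal.top_ne_zero (x - y) m
    rw [dist_eq_norm]
    simpa [Real.norm_eq_abs] using h
  rw [Real.dist_eq, ← sub_div, ← Finset.sum_sub_distrib, abs_div, Nat.abs_cast]
  apply div_le_of_le_mul₀ (Nat.cast_nonneg n) dist_nonneg
  calc |∑ i ∈ Finset.range n, (x (j + i) - y (j + i))|
      ≤ ∑ i ∈ Finset.range n, |x (j + i) - y (j + i)| := Finset.abs_sum_le_sum_abs _ _
    _ ≤ ∑ _i ∈ Finset.range n, dist x y := Finset.sum_le_sum fun i _ => hpt _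
    _ = dist x y * n := by simp [mul_comm]

theorem almostConvTo_dist_le (x y : LInf) (s t : ℝ)
    (hx : AlmostConvTo (fun n => x n) s) (hy : AlmostConvTo (fun n => y n) t) :
    dist s t ≤ dist x y :=
  le_of_tendsto ((hx.tendsto_at 0).dist (hy.tendsto_at 0))
    (Eventually.of_forall fun n => mean_dist_le x y n 0)

theorem almostConvTo_limit (u : ℕ → LInf) (x : LInf) (s : ℕ → ℝ) (t : ℝ)
    (hu : Tendsto u atTop (nhds x)) (hs : Tendsto s atTop (nhds t))
    (h : ∀ k, AlmostConvTo (fun n => u k n) (s k)) : AlmostConvTo (fun n => x n) t := by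
  unfold AlmostConvTo
  rw [Metric.tendstoUniformly_iff]
  intro ε hε
  obtain ⟨k, hk1, hk2⟩ := ((Metric.tendsto_nhds.1 hu (ε / 3) (by positivity)).and
    (Metric.tendsto_nhds.1 hs (ε / 3) (by positivity))).exists
  have hk := h k
  unfold AlmostConvTo at hk
  rw [Metric.tendstoUniformly_iff] at hk
  filter_upwards [hk (ε / 3) (by positivity)] with n hn j
  have h1 := hn j
  have h2 := mean_dist_le (u k) x n j
  have h3 := dist_triangle4 t (s k) ((∑ i ∈ Finset.range n, u k (j + i)) / (n : ℝ))
    ((∑ i ∈ Finset.range n, x (j + i)) / (n : ℝ))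
  rw [dist_comm] at hk2
  linarith

/-- The set `ĉ` of almost convergent sequences and the set `ĉ₀` of sequences almost
convergent to `0` are closed in `ℓ∞`. -/
theorem stmt4 :
    IsClosed {x : LInf | ∃ s : ℝ, AlmostConvTo (fun n => x n) s} ∧
    IsClosed {x : LInf | AlmostConvTo (fun n => x n) 0} := by
  constructor
  · apply IsSeqClosed.isClosed
    intro u x hu hx
    choose s hs using hu
    have hc : CauchySeq s := by
      rw [Metric.cauchySeq_iff]
      intro ε hε
      obtain ⟨N, hN⟩ := Metric.cauchySeq_iff.1 hx.cauchySeq ε hε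
      exact ⟨N, fun m hm n hn =>
        (almostConvTo_dist_le _ _ _ _ (hs m) (hs n)).trans_lt (hN m hm n hn)⟩
    obtain ⟨t, ht⟩ := cauchySeq_tendsto_of_complete hc
    exact ⟨t, almostConvTo_limit u x s t hx ht hs⟩
  · apply IsSeqClosed.isClosed
    intro u x hu hx
    exact almostConvTo_limit u x (fun _ => 0) 0 hx tendsto_const_nhds hu
end
end

section
/- If a subset M of a real normed space X is c-porous, then M is strongly lower porous. -/
open Filter
open scoped ENNReal Topology

noncomputable section

/-- `M` is c-porous: for every `x` and `r > 0` there are `y ∈ B(x,r)` and a nonzero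
continuous linear functional `φ` with `{z : φ(z) > φ(y)} ∩ M = ∅`. -/
def CPorous {X : Type*} [NormedAddCommGroup X] [NormedSpace ℝ X] (M : Set X) : Prop :=
  ∀ x : X, ∀ r : ℝ, 0 < r → ∃ y ∈ Metric.ball x r, ∃ φ : X →L[ℝ] ℝ, φ ≠ 0 ∧
    {z : X | φ y < φ z} ∩ M = ∅

/-- `γ(x,R,E) = sup {r > 0 : ∃ z, B(z,r) ⊆ B(x,R) \ E}`. -/
noncomputable def porGamma {X : Type*} [PseudoMetricSpace X] (x : X) (R : ℝ) (E : Set X) :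
    ℝ :=
  sSup {r : ℝ | 0 < r ∧ ∃ z : X, Metric.ball z r ⊆ Metric.ball x R \ E}

/-- `E` is strongly lower porous: at every point `x ∈ E` the lower porosity
`2 · liminf_{R → 0⁺} γ(x,R,E)/R` equals `1`. -/
def StronglyLowerPorous {X : Type*} [PseudoMetricSpace X] (E : Set X) : Prop :=
  ∀ x ∈ E, 2 * liminf (fun R : ℝ => porGamma x R E / R) (𝓝[>] 0) = 1

theorem porGamma_eq_half {X : Type*} [NormedAddCommGroup X] [NormedSpace ℝ X] (M : Set X)
    (h : CPorous M) (x : X) (hx : x ∈ M) (R : ℝ) (hR : 0 < R) : porGamma x R M = R / 2 := by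
  have hub : ∀ r ∈ {r : ℝ | 0 < r ∧ ∃ z : X, Metric.ball z r ⊆ Metric.ball x R \ M},
      r ≤ R / 2 := by
    rintro r ⟨hr, z, hz⟩
    have h1 : r ≤ ‖z - x‖ := by
      by_contra! hlt
      have : x ∈ Metric.ball z r := by
        rw [Metric.mem_ball, dist_comm, dist_eq_norm]; exact hlt
      exact (hz this).2 hx
    have hpos : 0 < ‖z - x‖ := lt_of_lt_of_le hr h1
    have h2 : r ≤ R - ‖z - x‖ := by
      apply le_of_forall_lt_imp_le_of_dense
      intro t ht
      by_cases ht0 : t ≤ 0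
      · have := (hz (Metric.mem_ball_self hr)).1
        rw [Metric.mem_ball, dist_eq_norm] at this
        linarith
      push Not at ht0
      have hw : z + (t / ‖z - x‖) • (z - x) ∈ Metric.ball z r := by
        rw [Metric.mem_ball, dist_eq_norm, add_sub_cancel_left, norm_smul, Real.norm_eq_abs,
          abs_of_pos (by positivity), div_mul_cancel₀ _ hpos.ne']
        exact ht
      have := (hz hw).1
      have e : z + (t / ‖z - x‖) • (z - x) - x = (1 + t / ‖z - x‖) • (z - x) := by
        rw [add_smul, one_smul]; abel
      rw [Metric.mem_ball, dist_eq_norm, e, norm_smul, Real.norm_eq_abs,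
          abs_of_pos (by positivity), add_mul, div_mul_cancel₀ _ hpos.ne'] at this
      linarith
    linarith
  have hlow : ∀ r, 0 < r → r < R / 2 →
      r ∈ {r : ℝ | 0 < r ∧ ∃ z : X, Metric.ball z r ⊆ Metric.ball x R \ M} := by
    intro r hr hrR
    refine ⟨hr, ?_⟩
    obtain ⟨y, hy, φ, hφ, hM⟩ := h x ((R / 2 - r) / 2) (by linarith)
    rw [Metric.mem_ball, dist_eq_norm] at hy
    have hn : 0 < ‖φ‖ := norm_pos_iff.mpr hφ
    have hc : (1 - (R / 2 - r) / R) * ‖φ‖ < ‖φ‖ := by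
      have : 0 < (R / 2 - r) / R := div_pos (by linarith) hR
      nlinarith
    obtain ⟨u, hu1, hu⟩ : ∃ u : X, ‖u‖ < 1 ∧ (1 - (R / 2 - r) / R) * ‖φ‖ < φ u := by
      obtain ⟨u, hu1, hu⟩ := φ.exists_lt_apply_of_lt_opNorm hc
      rcases le_total 0 (φ u) with h0 | h0
      · exact ⟨u, hu1, by rwa [Real.norm_of_nonneg h0] at hu⟩
      · refine ⟨-u, by rwa [norm_neg], ?_⟩
        rw [Real.norm_of_nonpos h0] at hu
        rwa [map_neg]
    have hu' : (R / 2 - (R / 2 - r) / 2) * ‖φ‖ < R / 2 * φ u := by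
      have := mul_lt_mul_of_pos_left hu (half_pos hR)
      have e : R / 2 * ((1 - (R / 2 - r) / R) * ‖φ‖) = (R / 2 - (R / 2 - r) / 2) * ‖φ‖ := by
        field_simp
      rwa [e] at this
    refine ⟨x + (R / 2) • u, fun w hw => ?_⟩
    rw [Metric.mem_ball, dist_eq_norm] at hw
    constructor
    · rw [Metric.mem_ball, dist_eq_norm]
      have e : w - x = (w - (x + (R / 2) • u)) + (R / 2) • u := by abel
      have h1 := norm_add_le (w - (x + (R / 2) • u)) ((R / 2) • u)
      rw [← e, norm_smul, Real.norm_of_nonneg (half_pos hR).le] at h1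
      nlinarith
    · intro hwM
      have hmem : w ∈ {z : X | φ y < φ z} ∩ M := by
        refine ⟨?_, hwM⟩
        have h1 := (abs_le.mp (φ.le_opNorm (w - (x + (R / 2) • u)))).1
        have h2 := (abs_le.mp (φ.le_opNorm (y - x))).2
        simp only [map_sub, map_add, map_smul, smul_eq_mul] at h1 h2
        have h3 := mul_le_mul_of_nonneg_left hw.le hn.le
        have h4 := mul_le_mul_of_nonneg_left hy.le hn.le
        show φ y < φ w
        linarith
      rw [hM] at hmem
      exact hmem
  unfold porGamma
  apply le_antisymm
  · exact csSup_le ⟨R / 4, hlow _ (by linarith) (by linarith)⟩ hub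
  · apply le_of_forall_lt_imp_le_of_dense
    intro t ht
    have : max t (R / 4) < R / 2 := max_lt ht (by linarith)
    exact (le_max_left t (R / 4)).trans
      (le_csSup ⟨R / 2, hub⟩ (hlow _ (lt_max_of_lt_right (by linarith)) this))

/-- A c-porous subset of a real normed space is strongly lower porous. -/
theorem stmt6 {X : Type*} [NormedAddCommGroup X] [NormedSpace ℝ X] (M : Set X)
    (h : CPorous M) : StronglyLowerPorous M := by
  intro x hx
  have hev : (fun R : ℝ => porGamma x R M / R) =ᶠ[𝓝[>] 0] fun _ => (1 / 2 : ℝ) := by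
    filter_upwards [self_mem_nhdsWithin] with R hR
    have hR' : 0 < R := hR
    rw [porGamma_eq_half M h x hx R hR']
    field_simp
  rw [liminf_congr hev, liminf_const]
  norm_num
end
end

section
/- The set c of convergent real sequences is strongly lower porous as a subset of the metric space ĉ of almost convergent sequences (with the metric induced by the supremum norm). -/
open Filter
open scoped ENNReal Topology

noncomputable section

/-- `ĉ`, the metric space of almost convergent sequences with the sup-norm metric. -/
abbrev cHat : Type := {y : LInf // ∃ s : ℝ, AlmostConvTo (fun n => y n) s}

theorem AlmostConvTo.lin {x y : ℕ → ℝ} {s t : ℝ} (hx : AlmostConvTo x s) (hy : AlmostConvTo y t)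
    (a b : ℝ) : AlmostConvTo (fun n => a * x n + b * y n) (a * s + b * t) := by
  unfold AlmostConvTo at *
  rw [Metric.tendstoUniformly_iff] at *
  intro ε hε
  have hA : 0 < |a| + |b| + 1 := by positivity
  have hd : 0 < ε / (|a| + |b| + 1) := by positivity
  filter_upwards [hx _ hd, hy _ hd] with n h1 h2 j
  have h1 := h1 j
  have h2 := h2 j
  rw [Real.dist_eq] at *
  have e : (a * s + b * t) - (∑ i ∈ Finset.range n, (a * x (j + i) + b * y (j + i))) / n
      = a * (s - (∑ i ∈ Finset.range n, x (j + i)) / n)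
        + b * (t - (∑ i ∈ Finset.range n, y (j + i)) / n) := by
    rw [Finset.sum_add_distrib, ← Finset.mul_sum, ← Finset.mul_sum]
    ring
  rw [e]
  have h3 := abs_add_le (a * (s - (∑ i ∈ Finset.range n, x (j + i)) / n))
    (b * (t - (∑ i ∈ Finset.range n, y (j + i)) / n))
  rw [abs_mul, abs_mul] at h3
  have h4 := mul_le_mul_of_nonneg_left h1.le (abs_nonneg a)
  have h5 := mul_le_mul_of_nonneg_left h2.le (abs_nonneg b)
  have h6 : (|a| + |b| + 1) * (ε / (|a| + |b| + 1)) = ε := by field_simp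
  nlinarith

theorem almostConvTo_alt : AlmostConvTo (fun n => (-1 : ℝ) ^ n) 0 := by
  unfold AlmostConvTo
  rw [Metric.tendstoUniformly_iff]
  intro ε hε
  have h := (tendsto_one_div_atTop_nhds_zero_nat (𝕜 := ℝ)).eventually (gt_mem_nhds hε)
  filter_upwards [h] with n hn j
  refine lt_of_le_of_lt ?_ hn
  rw [Real.dist_eq, zero_sub, abs_neg, abs_div, Nat.abs_cast]
  gcongr
  simp_rw [pow_add]
  rw [← Finset.mul_sum, neg_one_geom_sum, abs_mul, abs_pow, abs_neg, abs_one, one_pow, one_mul]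
  split_ifs <;> simp

def altSeq : LInf := ⟨fun n => (-1 : ℝ) ^ n, memℓp_infty ⟨1, by rintro _ ⟨n, rfl⟩; simp⟩⟩

theorem altSeq_apply (n : ℕ) : altSeq n = (-1 : ℝ) ^ n := rfl

theorem norm_altSeq_le : ‖altSeq‖ ≤ 1 :=
  lp.norm_le_of_forall_le zero_le_one (fun n => by rw [altSeq_apply]; simp)

theorem porGamma_eq (x : cHat)
    (hx : x ∈ {x : cHat | ∃ l : ℝ, Tendsto (fun n : ℕ => (x : LInf) n) atTop (nhds l)})
    {R : ℝ} (hR : 0 < R) :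
    porGamma x R {x : cHat | ∃ l : ℝ, Tendsto (fun n : ℕ => (x : LInf) n) atTop (nhds l)}
      = R / 2 := by
  apply IsGreatest.csSup_eq
  constructor
  · refine ⟨by positivity, ⟨⟨(x : LInf) + (R / 2) • altSeq, ?_⟩, ?_⟩⟩
    · obtain ⟨s, hs⟩ := x.2
      refine ⟨1 * s + R / 2 * 0, ?_⟩
      · convert hs.lin almostConvTo_alt 1 (R / 2) using 2 with n
        rw [lp.coeFn_add, lp.coeFn_smul]
        simp [altSeq_apply]
    · intro w hw
      rw [Metric.mem_ball, Subtype.dist_eq, dist_eq_norm] at hw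
      simp only at hw
      refine ⟨?_, ?_⟩
      · rw [Metric.mem_ball, Subtype.dist_eq, dist_eq_norm]
        have e : (w : LInf) - x = (w - (x + (R / 2) • altSeq)) + (R / 2) • altSeq := by abel
        rw [e]
        have h1 := norm_add_le ((w : LInf) - (x + (R / 2) • altSeq)) ((R / 2) • altSeq)
        have h2 : ‖(R / 2) • altSeq‖ ≤ R / 2 := by
          rw [norm_smul, Real.norm_of_nonneg (by positivity)]
          have := norm_altSeq_le
          nlinarith
        linarith
      · rintro ⟨m, hm⟩
        obtain ⟨l, hl⟩ := hx
        set δ := ‖(w : LInf) - (x + (R / 2) • altSeq)‖ with hδ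
        have hb : ∀ n, |(w : LInf) n - (x : LInf) n - R / 2 * (-1) ^ n| ≤ δ := by
          intro n
          have := lp.norm_apply_le_norm ENNReal.top_ne_zero
            ((w : LInf) - ((x : LInf) + (R / 2) • altSeq)) n
          rw [lp.coeFn_sub, lp.coeFn_add, lp.coeFn_smul] at this
          simp only [Pi.sub_apply, Pi.add_apply, Pi.smul_apply, altSeq_apply, smul_eq_mul,
            Real.norm_eq_abs, ← sub_sub] at this
          rwa [hδ, ← sub_sub]
        have hd := hm.sub hl
        have he : Tendsto (fun n : ℕ => 2 * n) atTop atTop :=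
          tendsto_id.const_mul_atTop' (by norm_num)
        have ho : Tendsto (fun n : ℕ => 2 * n + 1) atTop atTop :=
          (tendsto_add_atTop_nat 1).comp he
        have h1 : R / 2 - δ ≤ m - l := by
          refine ge_of_tendsto' (hd.comp he) (fun n => ?_)
          have := (abs_le.1 (hb (2 * n))).1
          rw [pow_mul] at this
          norm_num at this
          simp only [Function.comp]
          linarith
        have h2 : m - l ≤ -(R / 2 - δ) := by
          refine le_of_tendsto' (hd.comp ho) (fun n => ?_)
          have := (abs_le.1 (hb (2 * n + 1))).2
          rw [pow_succ, pow_mul] at this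
          norm_num at this
          simp only [Function.comp]
          linarith
        linarith
  · rintro r ⟨hr, z, hz⟩
    have hxz : r ≤ dist x z := by
      by_contra! h
      exact (hz (Metric.mem_ball.2 h)).2 hx
    rw [Subtype.dist_eq, dist_comm, dist_eq_norm] at hxz
    set d := ‖(z : LInf) - x‖ with hd
    have hd0 : 0 < d := hr.trans_le hxz
    have key : ∀ s, 0 ≤ s → s < r → d + s ≤ R := by
      intro s hs hsr
      have hmem : ∃ u : ℝ, AlmostConvTo
          (fun n => ((z : LInf) + (s / d) • ((z : LInf) - x)) n) u := by
        obtain ⟨a, ha⟩ := z.2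
        obtain ⟨b, hb⟩ := x.2
        refine ⟨(1 + s / d) * a + -(s / d) * b, ?_⟩
        · convert ha.lin hb (1 + s / d) (-(s / d)) using 2 with n
          rw [lp.coeFn_add, lp.coeFn_smul, lp.coeFn_sub]
          simp
          ring
      have := (hz (a := ⟨_, hmem⟩) (by
        rw [Metric.mem_ball, Subtype.dist_eq, dist_eq_norm]
        simp only [add_sub_cancel_left]
        rw [norm_smul, ← hd, Real.norm_of_nonneg (by positivity)]
        rwa [div_mul_cancel₀ _ hd0.ne'])).1
      rw [Metric.mem_ball, Subtype.dist_eq, dist_eq_norm] at this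
      simp only at this
      have e : (z : LInf) + (s / d) • ((z : LInf) - x) - x = (1 + s / d) • ((z : LInf) - x) := by
        rw [add_smul, one_smul]; abel
      rw [e, norm_smul, ← hd, Real.norm_of_nonneg (by positivity), add_mul,
        div_mul_cancel₀ _ hd0.ne'] at this
      linarith
    by_contra! h
    have h1 := key ((R / 2 + r) / 2) (by positivity) (by linarith)
    linarith

/-- The set `c` of convergent sequences is strongly lower porous in `ĉ`. -/
theorem stmt7 :
    StronglyLowerPorous
      {x : cHat | ∃ l : ℝ, Tendsto (fun n : ℕ => (x : LInf) n) atTop (nhds l)} := by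
  intro x hx
  have h : liminf (fun R : ℝ => porGamma x R
      {x : cHat | ∃ l : ℝ, Tendsto (fun n : ℕ => (x : LInf) n) atTop (nhds l)} / R) (𝓝[>] 0)
      = liminf (fun _ : ℝ => (1 / 2 : ℝ)) (𝓝[>] (0 : ℝ)) := by
    apply liminf_congr
    filter_upwards [self_mem_nhdsWithin] with R hR
    have hR : 0 < R := hR
    rw [porGamma_eq x hx hR]
    field_simp
  rw [h, liminf_const]
  norm_num
end
end

section
/- The set ĉ₀ of sequences almost convergent to 0 is strongly lower porous as a subset of the metric space S₀ of bounded sequences whose arithmetic means converge to 0 (with the metric induced by the supremum norm). -/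
open Filter
open scoped ENNReal Topology

noncomputable section

/-- `S₀`, the metric space of bounded sequences whose arithmetic means converge to `0`,
with the sup-norm metric. -/
abbrev spaceSZero : Type :=
  {y : LInf // Tendsto (fun n : ℕ => (∑ i ∈ Finset.range n, y i) / n) atTop (nhds 0)}

/-- Indicator of the blocks `[2^k, 2^k + k)`. -/
def blockU (n : ℕ) : ℝ := by
  classical exact if ∃ k, 2 ^ k ≤ n ∧ n < 2 ^ k + k then 1 else 0

lemma blockU_nonneg (n : ℕ) : 0 ≤ blockU n := by
  unfold blockU; split_ifs <;> norm_num

lemma blockU_le_one (n : ℕ) : blockU n ≤ 1 := by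
  unfold blockU; split_ifs <;> norm_num

lemma blockU_block (k i : ℕ) (h : i < k) : blockU (2 ^ k + i) = 1 := by
  unfold blockU
  rw [if_pos ⟨k, by omega, by omega⟩]

lemma blockU_sum_le (N : ℕ) :
    (∑ i ∈ Finset.range N, blockU i) ≤ ((Nat.log 2 N : ℝ) + 1) ^ 2 := by
  classical
  have h1 : (∑ i ∈ Finset.range N, blockU i) =
      (((Finset.range N).filter (fun n => ∃ k, 2 ^ k ≤ n ∧ n < 2 ^ k + k)).card : ℝ) := by
    unfold blockU
    rw [Finset.sum_boole]
  rw [h1]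
  have h2 : (Finset.range N).filter (fun n => ∃ k, 2 ^ k ≤ n ∧ n < 2 ^ k + k) ⊆
      (Finset.range (Nat.log 2 N + 1)).biUnion (fun k => Finset.Ico (2 ^ k) (2 ^ k + k)) := by
    intro n hn
    simp only [Finset.mem_filter, Finset.mem_range] at hn
    obtain ⟨hn, k, hk, hk'⟩ := hn
    simp only [Finset.mem_biUnion, Finset.mem_range, Finset.mem_Ico]
    refine ⟨k, ?_, hk, hk'⟩
    have := Nat.le_log_of_pow_le (b := 2) (by norm_num) (hk.trans hn.le)
    omega
  have h3 := (Finset.card_le_card h2).trans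
    (Finset.card_biUnion_le_card_mul _ _ (Nat.log 2 N + 1) (by
      intro k hk
      simp only [Finset.mem_range] at hk
      simp; omega))
  rw [Finset.card_range] at h3
  rw [sq]
  exact_mod_cast h3

lemma blockU_tendsto :
    Tendsto (fun n : ℕ => (∑ i ∈ Finset.range n, blockU i) / n) atTop (nhds 0) := by
  have h1 : Tendsto (fun m : ℕ => 2 * (((m + 1 : ℕ) : ℝ) ^ 2 / 2 ^ (m + 1))) atTop (nhds 0) := by
    have := (tendsto_pow_const_div_const_pow_of_one_lt 2 (r := (2 : ℝ)) (by norm_num))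
    have := ((tendsto_add_atTop_iff_nat 1).2 this).const_mul 2
    simpa using this
  have hlog : Tendsto (fun n : ℕ => Nat.log 2 n) atTop atTop := by
    refine tendsto_atTop_atTop.2 fun b => ⟨2 ^ b, fun a ha => ?_⟩
    exact Nat.le_log_of_pow_le (by norm_num) ha
  refine squeeze_zero' (Eventually.of_forall fun n => ?_) ?_ (h1.comp hlog)
  · exact div_nonneg (Finset.sum_nonneg fun i _ => blockU_nonneg i) (Nat.cast_nonneg n)
  · filter_upwards [eventually_gt_atTop 0] with n hn
    have hp : (2 : ℝ) ^ (Nat.log 2 n) ≤ n := by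
      exact_mod_cast Nat.pow_log_le_self 2 hn.ne'
    have hp0 : (0 : ℝ) < 2 ^ (Nat.log 2 n) := by positivity
    have h3 : (∑ i ∈ Finset.range n, blockU i) / n ≤
        ((Nat.log 2 n : ℝ) + 1) ^ 2 / 2 ^ (Nat.log 2 n) :=
      div_le_div₀ (by positivity) (blockU_sum_le n) hp0 hp
    refine h3.trans (le_of_eq ?_)
    simp only [Function.comp]
    push_cast
    rw [pow_succ (2 : ℝ) (Nat.log 2 n)]
    field_simp

/-- The block sequence as an element of `ℓ∞`. -/
def blockL : LInf := ⟨blockU, memℓp_infty ⟨1, by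
  rintro _ ⟨n, rfl⟩
  simp only [Real.norm_eq_abs]
  rw [abs_of_nonneg (blockU_nonneg n)]
  exact blockU_le_one n⟩⟩

lemma norm_blockL : ‖blockL‖ ≤ 1 := by
  refine lp.norm_le_of_forall_le zero_le_one fun n => ?_
  change ‖blockU n‖ ≤ 1
  rw [Real.norm_eq_abs, abs_of_nonneg (blockU_nonneg n)]
  exact blockU_le_one n

lemma comb_tendsto (x y : LInf) (a b : ℝ)
    (hx : Tendsto (fun n : ℕ => (∑ i ∈ Finset.range n, x i) / n) atTop (nhds 0))
    (hy : Tendsto (fun n : ℕ => (∑ i ∈ Finset.range n, y i) / n) atTop (nhds 0)) :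
    Tendsto (fun n : ℕ => (∑ i ∈ Finset.range n, (a • x + b • y : LInf) i) / n)
      atTop (nhds 0) := by
  have := (hx.const_mul a).add (hy.const_mul b)
  simp only [mul_zero, add_zero] at this
  refine this.congr fun n => ?_
  simp only [lp.coeFn_add, lp.coeFn_smul, Pi.add_apply, Pi.smul_apply, smul_eq_mul,
    Finset.sum_add_distrib, ← Finset.mul_sum]
  ring

lemma por_upper (E : Set spaceSZero) (x : spaceSZero) (hx : x ∈ E) (R r : ℝ) (hr : 0 < r)
    (z : spaceSZero) (hz : Metric.ball z r ⊆ Metric.ball x R \ E) : r ≤ R / 2 := by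
  have hd : r ≤ dist z x := by
    by_contra! h
    exact (hz (by rw [Metric.mem_ball, dist_comm]; exact h : x ∈ Metric.ball z r)).2 hx
  set v : LInf := z.1 - x.1 with hv
  have hnv : dist z x = ‖v‖ := by rw [Subtype.dist_eq, dist_eq_norm]
  have hvpos : 0 < ‖v‖ := by rw [← hnv]; linarith
  have key : ∀ t, 0 < t → t < r → ‖v‖ + t ≤ R := by
    intro t ht htr
    set c := t / ‖v‖ with hc
    have hcpos : 0 < c := by positivity
    let w : spaceSZero := ⟨(1 + c) • z.1 + (-c) • x.1, comb_tendsto _ _ _ _ z.2 x.2⟩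
    have hw : w ∈ Metric.ball z r := by
      rw [Metric.mem_ball, Subtype.dist_eq, dist_eq_norm]
      have : w.1 - z.1 = c • v := by simp only [w, hv]; module
      rw [this, norm_smul, Real.norm_eq_abs, abs_of_pos hcpos, hc, div_mul_cancel₀ _ hvpos.ne']
      exact htr
    have h2 := (hz hw).1
    rw [Metric.mem_ball, Subtype.dist_eq, dist_eq_norm] at h2
    have : w.1 - x.1 = (1 + c) • v := by simp only [w, hv]; module
    rw [this, norm_smul, Real.norm_eq_abs, abs_of_pos (by linarith), add_mul, one_mul, hc,
      div_mul_cancel₀ _ hvpos.ne'] at h2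
    exact h2.le
  by_contra! h
  have h4 := key (max (r / 2) ((r + R / 2) / 2)) (lt_max_of_lt_left (by linarith))
    (max_lt (by linarith) (by linarith))
  have := le_max_right (r / 2) ((r + R / 2) / 2)
  rw [hnv] at hd
  linarith

lemma por_lower (x : spaceSZero) (hx : AlmostConvTo (fun n => (x : LInf) n) 0) (R : ℝ)
    (hR : 0 < R) : ∃ z : spaceSZero, Metric.ball z (R / 2) ⊆
      Metric.ball x R \ {x : spaceSZero | AlmostConvTo (fun n => (x : LInf) n) 0} := by
  refine ⟨⟨(1 : ℝ) • x.1 + (R / 2) • blockL, comb_tendsto _ _ _ _ x.2 blockU_tendsto⟩, ?_⟩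
  intro w hw
  rw [Metric.mem_ball, Subtype.dist_eq, dist_eq_norm] at hw
  simp only [one_smul] at hw
  constructor
  · rw [Metric.mem_ball, Subtype.dist_eq, dist_eq_norm]
    have h1 : w.1 - x.1 = (w.1 - (x.1 + (R / 2) • blockL)) + (R / 2) • blockL := by abel
    rw [h1]
    have h2 : ‖(R / 2) • blockL‖ ≤ R / 2 := by
      rw [norm_smul, Real.norm_eq_abs, abs_of_pos (by linarith)]
      have := norm_blockL
      nlinarith
    have := norm_add_le (w.1 - (x.1 + (R / 2) • blockL)) ((R / 2) • blockL)
    linarith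
  · intro hwE
    simp only [Set.mem_ofPred_eq] at hwE
    set ρ := ‖w.1 - (x.1 + (R / 2) • blockL)‖ with hρ
    set δ := (R / 2 - ρ) / 2 with hδ
    have hδpos : 0 < δ := by linarith
    unfold AlmostConvTo at hx hwE
    rw [Metric.tendstoUniformly_iff] at hx hwE
    obtain ⟨n, hn1, hn2, hn0⟩ :=
      ((hx δ hδpos).and ((hwE δ hδpos).and (eventually_gt_atTop 0))).exists
    have a1 := hn1 (2 ^ n)
    have a2 := hn2 (2 ^ n)
    rw [dist_comm, Real.dist_eq, sub_zero, abs_lt] at a1 a2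
    have hn0' : (0 : ℝ) < n := by exact_mod_cast hn0
    have hs : ∑ i ∈ Finset.range n, (x.1 (2 ^ n + i) + 2 * δ) ≤
        ∑ i ∈ Finset.range n, w.1 (2 ^ n + i) := by
      refine Finset.sum_le_sum fun i hi => ?_
      have h1 := lp.norm_apply_le_norm ENNReal.top_ne_zero
        (w.1 - (x.1 + (R / 2) • blockL)) (2 ^ n + i)
      have h2 : blockL (2 ^ n + i) = 1 := blockU_block n i (Finset.mem_range.1 hi)
      simp only [lp.coeFn_sub, lp.coeFn_add, lp.coeFn_smul, Pi.sub_apply, Pi.add_apply,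
        Pi.smul_apply, smul_eq_mul, h2, Real.norm_eq_abs] at h1
      have h3 := (abs_le.1 h1).1
      rw [← hρ] at h3
      linarith
    rw [Finset.sum_add_distrib, Finset.sum_const, Finset.card_range, nsmul_eq_mul] at hs
    have b1 := a1.1
    have b2 := a2.2
    rw [div_lt_iff₀ hn0'] at b2
    rw [lt_div_iff₀ hn0'] at b1
    nlinarith

/-- The set `ĉ₀` of sequences almost convergent to `0` is strongly lower porous in `S₀`. -/
theorem stmt10 :
    StronglyLowerPorous
      {x : spaceSZero | AlmostConvTo (fun n => (x : LInf) n) 0} := by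
  intro x hx
  have h : ∀ R : ℝ, 0 < R → porGamma x R
      {x : spaceSZero | AlmostConvTo (fun n => (x : LInf) n) 0} / R = 1 / 2 := by
    intro R hR
    have hg : IsGreatest {r : ℝ | 0 < r ∧ ∃ z : spaceSZero, Metric.ball z r ⊆ Metric.ball x R \
        {x : spaceSZero | AlmostConvTo (fun n => (x : LInf) n) 0}} (R / 2) := by
      refine ⟨⟨by linarith, por_lower x hx R hR⟩, ?_⟩
      rintro r ⟨hr, z, hz⟩
      exact por_upper _ x hx R r hr z hz
    unfold porGamma
    rw [hg.csSup_eq]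
    field_simp
  have h2 : (fun R : ℝ => porGamma x R
      {x : spaceSZero | AlmostConvTo (fun n => (x : LInf) n) 0} / R) =ᶠ[𝓝[>] 0]
      fun _ => (1 / 2 : ℝ) := by
    filter_upwards [self_mem_nhdsWithin] with R hR
    exact h R hR
  rw [liminf_congr h2, liminf_const]
  norm_num
end
end

section
/- The set S of bounded sequences with convergent arithmetic means is strongly lower porous as a subset of ℓ∞ (with the metric induced by the supremum norm). -/
open Filter
open scoped ENNReal Topology

noncomputable section

/-- The oscillating sign sequence. -/
def oscEps (i : ℕ) : ℝ := (-1) ^ (Nat.log 2 (Nat.log 2 i))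

lemma abs_oscEps (i : ℕ) : |oscEps i| = 1 := by
  simp [oscEps, abs_pow]

lemma oscEps_block (k i : ℕ) (h1 : 2 ^ 2 ^ k ≤ i) (h2 : i < 2 ^ 2 ^ (k + 1)) :
    oscEps i = (-1) ^ k := by
  have h0 : i ≠ 0 := by
    have : 0 < 2 ^ 2 ^ k := by positivity
    omega
  have a1 : 2 ^ k ≤ Nat.log 2 i := (Nat.le_log_iff_pow_le (by norm_num) h0).2 h1
  have a2 : Nat.log 2 i < 2 ^ (k + 1) := (Nat.log_lt_iff_lt_pow (by norm_num) h0).2 h2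
  have : Nat.log 2 (Nat.log 2 i) = k := Nat.log_eq_of_pow_le_of_lt_pow a1 a2
  rw [oscEps, this]

lemma sum_oscEps (k : ℕ) :
    ((2 ^ 2 ^ (k + 1) : ℕ) : ℝ) - 2 * ((2 ^ 2 ^ k : ℕ) : ℝ) ≤
      (-1) ^ k * ∑ i ∈ Finset.range (2 ^ 2 ^ (k + 1)), oscEps i := by
  have hs : ((-1 : ℝ) ^ k) * (-1) ^ k = 1 := by
    rw [← mul_pow]; norm_num
  have hle : 2 ^ 2 ^ k ≤ 2 ^ 2 ^ (k + 1) :=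
    Nat.pow_le_pow_right (by norm_num) (Nat.pow_le_pow_right (by norm_num) (by omega))
  have key : ∑ i ∈ Finset.range (2 ^ 2 ^ k), (1 - (-1) ^ k * oscEps i) =
      ∑ i ∈ Finset.range (2 ^ 2 ^ (k + 1)), (1 - (-1) ^ k * oscEps i) := by
    apply Finset.sum_subset
    · intro i hi
      rw [Finset.mem_range] at *
      omega
    · intro i hi hi'
      rw [Finset.mem_range] at *
      rw [oscEps_block k i (by omega) hi, hs, sub_self]
  have hb : ∑ i ∈ Finset.range (2 ^ 2 ^ k), (1 - (-1) ^ k * oscEps i) ≤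
      ∑ i ∈ Finset.range (2 ^ 2 ^ k), (2 : ℝ) := by
    apply Finset.sum_le_sum
    intro i _
    have : |(-1) ^ k * oscEps i| = 1 := by rw [abs_mul, abs_oscEps]; simp
    have := neg_abs_le ((-1) ^ k * oscEps i)
    linarith
  rw [key, Finset.sum_sub_distrib, ← Finset.mul_sum, Finset.sum_const, Finset.sum_const,
    Finset.card_range, Finset.card_range, nsmul_eq_mul, nsmul_eq_mul] at hb
  linarith

lemma tendsto_dexp : Tendsto (fun k : ℕ => 2 ^ 2 ^ k) atTop (atTop : Filter ℕ) :=
  (tendsto_pow_atTop_atTop_of_one_lt (by norm_num : 1 < 2)).comp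
    (tendsto_pow_atTop_atTop_of_one_lt (by norm_num : 1 < 2))

lemma mean_bound (v : ℕ → ℝ) (c ρ : ℝ) (hc : 0 < c)
    (hv : ∀ i, |v i - c * oscEps i| ≤ ρ) (k : ℕ) :
    c - ρ - 2 * c / ((2 ^ 2 ^ k : ℕ) : ℝ) ≤
      (-1) ^ k * ((∑ i ∈ Finset.range (2 ^ 2 ^ (k + 1)), v i) / ((2 ^ 2 ^ (k + 1) : ℕ) : ℝ)) := by
  have h := sum_oscEps k
  have hb : ∑ i ∈ Finset.range (2 ^ 2 ^ (k + 1)), (c * ((-1) ^ k * oscEps i) - ρ) ≤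
      ∑ i ∈ Finset.range (2 ^ 2 ^ (k + 1)), (-1) ^ k * v i := by
    apply Finset.sum_le_sum
    intro i _
    have h1 : |(-1) ^ k * (v i - c * oscEps i)| ≤ ρ := by
      rw [abs_mul]; simpa using hv i
    have := neg_abs_le ((-1) ^ k * (v i - c * oscEps i))
    linarith
  rw [Finset.sum_sub_distrib, ← Finset.mul_sum, ← Finset.mul_sum, ← Finset.mul_sum,
    Finset.sum_const, Finset.card_range, nsmul_eq_mul] at hb
  have hN : (0 : ℝ) < ((2 ^ 2 ^ k : ℕ) : ℝ) := by positivity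
  have hM : ((2 ^ 2 ^ (k + 1) : ℕ) : ℝ) = ((2 ^ 2 ^ k : ℕ) : ℝ) * ((2 ^ 2 ^ k : ℕ) : ℝ) := by
    rw [pow_succ 2 k, pow_mul]; push_cast; ring
  have hc' := mul_le_mul_of_nonneg_left h hc.le
  have h3 := hc'.trans (sub_le_iff_le_add.1 hb)
  rw [← mul_div_assoc, le_div_iff₀ (by rw [hM]; positivity)]
  generalize (-1) ^ k * ∑ i ∈ Finset.range (2 ^ 2 ^ (k + 1)), v i = T at *
  rw [hM] at *
  generalize ((2 ^ 2 ^ k : ℕ) : ℝ) = N at *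
  have : (c - ρ - 2 * c / N) * (N * N) = (c - ρ) * (N * N) - 2 * c * N := by
    field_simp
  rw [this]; linarith

lemma not_tendsto_mean (v : ℕ → ℝ) (c ρ : ℝ) (hc : 0 < c) (hρ : ρ < c)
    (hv : ∀ i, |v i - c * oscEps i| ≤ ρ) (L : ℝ)
    (hL : Tendsto (fun n : ℕ => (∑ i ∈ Finset.range n, v i) / (n : ℝ)) atTop (nhds L)) :
    False := by
  have hd : Tendsto (fun k : ℕ => c - ρ - 2 * c / ((2 ^ 2 ^ k : ℕ) : ℝ)) atTop
      (𝓝 (c - ρ - 0)) :=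
    tendsto_const_nhds.sub
      ((tendsto_natCast_atTop_atTop.comp tendsto_dexp).const_div_atTop (2 * c))
  have hm := hL.comp (tendsto_dexp.comp (tendsto_add_atTop_nat 1))
  have te : Tendsto (fun j : ℕ => 2 * j) atTop atTop :=
    tendsto_atTop_mono (fun j => by simp only [id]; omega) tendsto_id
  have tod : Tendsto (fun j : ℕ => 2 * j + 1) atTop atTop :=
    tendsto_atTop_mono (fun j => by simp only [id]; omega) tendsto_id
  have e1 : c - ρ - 0 ≤ L := by
    refine le_of_tendsto_of_tendsto' (hd.comp te) (hm.comp te) (fun j => ?_)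
    have := mean_bound v c ρ hc hv (2 * j)
    rw [pow_mul (-1 : ℝ)] at this
    simpa [Function.comp] using this
  have e2 : c - ρ - 0 ≤ -L := by
    refine le_of_tendsto_of_tendsto' (hd.comp tod) (hm.comp tod).neg (fun j => ?_)
    have := mean_bound v c ρ hc hv (2 * j + 1)
    rw [pow_succ (-1 : ℝ), pow_mul (-1 : ℝ)] at this
    simpa [Function.comp] using this
  linarith

lemma memlp_oscEps : Memℓp (E := fun _ : ℕ => ℝ) oscEps ∞ := by
  apply memℓp_infty
  refine ⟨1, ?_⟩
  rintro _ ⟨i, rfl⟩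
  simp [Real.norm_eq_abs, abs_oscEps]

/-- The oscillating sequence in `ℓ∞`. -/
def oscE : LInf := ⟨oscEps, memlp_oscEps⟩

lemma norm_oscE_le : ‖oscE‖ ≤ 1 :=
  lp.norm_le_of_forall_le zero_le_one (fun i => by
    change ‖oscEps i‖ ≤ 1
    rw [Real.norm_eq_abs, abs_oscEps])

lemma radius_le {X : Type*} [NormedAddCommGroup X] [NormedSpace ℝ X] (E : Set X) (x z : X)
    (hx : x ∈ E) (r R : ℝ) (hr : 0 < r) (h : Metric.ball z r ⊆ Metric.ball x R \ E) :
    r ≤ R / 2 := by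
  have hd : r ≤ ‖z - x‖ := by
    by_contra hlt
    push Not at hlt
    exact (h (show x ∈ Metric.ball z r by rwa [Metric.mem_ball, dist_comm, dist_eq_norm])).2 hx
  have hpos : 0 < ‖z - x‖ := hr.trans_le hd
  have hall : ∀ t, 0 < t → t < r → ‖z - x‖ + t < R := by
    intro t ht htr
    have hmem : z + (t / ‖z - x‖) • (z - x) ∈ Metric.ball z r := by
      rw [Metric.mem_ball, dist_eq_norm, add_sub_cancel_left, norm_smul, Real.norm_eq_abs,
        abs_of_pos (by positivity), div_mul_cancel₀ _ hpos.ne']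
      exact htr
    have := (h hmem).1
    rw [Metric.mem_ball, dist_eq_norm] at this
    have e : z + (t / ‖z - x‖) • (z - x) - x = (1 + t / ‖z - x‖) • (z - x) := by
      rw [add_smul, one_smul]; abel
    rw [e, norm_smul, Real.norm_eq_abs, abs_of_pos (by positivity), add_mul, one_mul,
      div_mul_cancel₀ _ hpos.ne'] at this
    exact this
  by_contra hlt
  push Not at hlt
  have hR : R < 2 * r := by linarith
  have := hall (max (R - r) (r / 2)) (lt_max_of_lt_right (by linarith))
    (max_lt (by linarith) (by linarith))
  have := le_max_left (R - r) (r / 2)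
  linarith

/-- The set `S` of bounded sequences whose arithmetic means converge is strongly lower
porous in `ℓ∞`. -/
theorem stmt11 :
    StronglyLowerPorous
      {x : LInf | ∃ l : ℝ,
        Tendsto (fun n : ℕ => (∑ i ∈ Finset.range n, x i) / n) atTop (nhds l)} := by
  intro x hx
  have key : ∀ R : ℝ, 0 < R → porGamma x R {x : LInf | ∃ l : ℝ,
        Tendsto (fun n : ℕ => (∑ i ∈ Finset.range n, x i) / n) atTop (nhds l)} = R / 2 := by
    intro R hR
    apply IsGreatest.csSup_eq
    refine ⟨⟨by positivity, x + (R / 2) • oscE, ?_⟩, ?_⟩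
    · intro w hw
      rw [Metric.mem_ball, dist_eq_norm] at hw
      have hn : ‖(R / 2) • oscE‖ ≤ R / 2 := by
        rw [norm_smul, Real.norm_eq_abs, abs_of_pos (by positivity)]
        exact mul_le_of_le_one_right (by positivity) norm_oscE_le
      refine ⟨?_, ?_⟩
      · rw [Metric.mem_ball, dist_eq_norm]
        have e : w - x = (w - (x + (R / 2) • oscE)) + (R / 2) • oscE := by abel
        rw [e]
        have := norm_add_le (w - (x + (R / 2) • oscE)) ((R / 2) • oscE)
        linarith
      · rintro ⟨l, hl⟩
        obtain ⟨l', hl'⟩ := hx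
        refine not_tendsto_mean (fun i => w i - x i) (R / 2) _ (by positivity) hw (fun i => ?_)
          (l - l') ?_
        · have := lp.norm_apply_le_norm (by simp) (w - (x + (R / 2) • oscE)) i
          have e : (w - (x + (R / 2) • oscE)) i = w i - x i - R / 2 * oscEps i := by
            change w i - (x i + R / 2 * oscEps i) = _
            ring
          rwa [e, Real.norm_eq_abs] at this
        · refine (hl.sub hl').congr (fun n => ?_)
          rw [Finset.sum_sub_distrib, sub_div]
    · rintro r ⟨hr, z, hz⟩
      exact radius_le _ x z hx r R hr hz
  have hev : (fun R : ℝ => porGamma x R {x : LInf | ∃ l : ℝ,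
        Tendsto (fun n : ℕ => (∑ i ∈ Finset.range n, x i) / n) atTop (nhds l)} / R)
      =ᶠ[𝓝[>] 0] fun _ => (1 / 2 : ℝ) := by
    filter_upwards [self_mem_nhdsWithin] with R hR
    have hR' : (0 : ℝ) < R := hR
    rw [key R hR']
    field_simp
  rw [liminf_congr hev, liminf_const]
  norm_num
end
end

section
/- Let f : ℝ → ℝ be an exponential-like function of rank m. Then for every c ∈ ℝ the preimage f⁻¹({c}) has at most m elements. -/
noncomputable section

/-- `f : ℝ → ℝ` is exponential-like of rank `m`: `f x = ∑_{i=1}^m αᵢ e^{βᵢ x}` with the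
`βᵢ` distinct and nonzero and the `αᵢ` nonzero. -/
def ExpLike (f : ℝ → ℝ) (m : ℕ) : Prop :=
  0 < m ∧ ∃ α β : Fin m → ℝ, (∀ i, α i ≠ 0) ∧ (∀ i, β i ≠ 0) ∧ Function.Injective β ∧
    ∀ x : ℝ, f x = ∑ i : Fin m, α i * Real.exp (β i * x)

lemma expsum_aux {ι : Type*} [DecidableEq ι] (n : ℕ) : ∀ (s : Finset ι) (α β : ι → ℝ) (c : ℝ),
    s.card = n → (∀ i ∈ s, α i ≠ 0) → (∀ i ∈ s, β i ≠ 0) → Set.InjOn β s →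
    (n ≠ 0 ∨ c ≠ 0) →
    {x : ℝ | ∑ i ∈ s, α i * Real.exp (β i * x) = c}.Finite ∧
    {x : ℝ | ∑ i ∈ s, α i * Real.exp (β i * x) = c}.ncard ≤ n := by
  induction n with
  | zero =>
    intro s α β c hs _ _ _ hc
    have hc : c ≠ 0 := by simpa using hc
    rw [Finset.card_eq_zero] at hs
    subst hs
    simp [hc.symm]
  | succ n ih =>
    intro s α β c hs hα hβ hinj _
    obtain ⟨j, hj⟩ : s.Nonempty := by
      rw [← Finset.card_pos]; omega
    have key := ih (s.erase j) (fun i => α i * β i) (fun i => β i - β j) (-(α j * β j))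
      (by rw [Finset.card_erase_of_mem hj]; omega)
      (fun i hi => mul_ne_zero (hα i (Finset.mem_of_mem_erase hi)) (hβ i (Finset.mem_of_mem_erase hi)))
      (fun i hi h => (Finset.ne_of_mem_erase hi)
        (hinj (Finset.mem_of_mem_erase hi) hj (sub_eq_zero.1 h)))
      (fun a ha b hb h => hinj (Finset.mem_of_mem_erase ha) (Finset.mem_of_mem_erase hb)
        (sub_left_injective h))
      (Or.inr (neg_ne_zero.2 (mul_ne_zero (hα j hj) (hβ j hj))))
    obtain ⟨hfin, hcard⟩ := key
    have hder : ∀ x : ℝ, HasDerivAt (fun x => ∑ i ∈ s, α i * Real.exp (β i * x))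
        (∑ i ∈ s, α i * (Real.exp (β i * x) * β i)) x := by
      intro x
      refine HasDerivAt.fun_sum fun i _ => ?_
      exact (((hasDerivAt_id x).const_mul (β i)).exp.const_mul (α i)).congr_deriv (by simp)
    have bound : ∀ T : Finset ℝ, (∀ x ∈ T, ∑ i ∈ s, α i * Real.exp (β i * x) = c) →
        T.card ≤ n + 1 := by
      intro T hT
      have h1 : T.card ≤ hfin.toFinset.card + 1 := by
        refine Finset.card_le_of_interleaved fun x hx y hy hxy _ => ?_
        obtain ⟨z, hz, hz0⟩ := exists_hasDerivAt_eq_zero hxy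
          (fun w _ => (hder w).continuousAt.continuousWithinAt)
          ((hT x hx).trans (hT y hy).symm) (fun w _ => hder w)
        refine ⟨z, ?_, hz.1, hz.2⟩
        rw [Set.Finite.mem_toFinset, Set.mem_ofPred_eq]
        rw [← Finset.add_sum_erase s _ hj] at hz0
        have h2 : ∑ i ∈ s.erase j, α i * (Real.exp (β i * z) * β i) =
            (∑ i ∈ s.erase j, α i * β i * Real.exp ((β i - β j) * z)) * Real.exp (β j * z) := by
          rw [Finset.sum_mul]
          refine Finset.sum_congr rfl fun i _ => ?_
          have : Real.exp (β i * z) = Real.exp ((β i - β j) * z) * Real.exp (β j * z) := by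
            rw [← Real.exp_add]; ring_nf
          rw [this]; ring
        rw [h2] at hz0
        have hp := Real.exp_pos (β j * z)
        apply mul_right_cancel₀ hp.ne'
        linarith
      rw [Set.ncard_eq_toFinset_card _ hfin] at hcard
      omega
    have hF : {x : ℝ | ∑ i ∈ s, α i * Real.exp (β i * x) = c}.Finite := by
      by_contra h
      obtain ⟨T, hT, hTc⟩ := Set.Infinite.exists_subset_card_eq h (n + 2)
      have := bound T (fun x hx => hT hx)
      omega
    refine ⟨hF, ?_⟩
    rw [Set.ncard_eq_toFinset_card _ hF]
    exact bound _ (fun x hx => by simpa using hx)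

/-- An exponential-like function of rank `m` attains each value at most `m` times:
every preimage `f⁻¹({c})` is finite with at most `m` elements. -/
theorem stmt12 (f : ℝ → ℝ) (m : ℕ) (hf : ExpLike f m) (c : ℝ) :
    (f ⁻¹' {c}).Finite ∧ (f ⁻¹' {c}).ncard ≤ m := by
  obtain ⟨hm, α, β, hα, hβ, hinj, h⟩ := hf
  have he : f ⁻¹' {c} = {x : ℝ | ∑ i, α i * Real.exp (β i * x) = c} := by
    ext x; simp [h]
  rw [he]
  exact expsum_aux m Finset.univ α β c (by simp) (fun i _ => hα i) (fun i _ => hβ i)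
    hinj.injOn (Or.inl hm.ne')
end
end

section
/- The family ĉ \ c (of almost convergent sequences that are not convergent) is strongly 𝔠-algebrable in ℓ∞ with coordinatewise multiplication. -/
open Filter
open scoped ENNReal

noncomputable section

/-- `A` is strongly `𝔠`-algebrable: `A ∪ {0}` contains a free subalgebra on continuum many
generators; equivalently, there is a set `G ⊆ A ∪ {0}` of cardinality `𝔠` such that for
every `n`, every nonzero real polynomial `P` in `n` variables with zero constant term and
all distinct `g₁, …, gₙ ∈ G`, the element `P(g₁, …, gₙ)` lies in `A` and is nonzero. -/
def StronglyContinuumAlgebrable {R : Type*} [CommRing R] [Algebra ℝ R] (A : Set R) : Prop :=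
  ∃ G : Set R, G ⊆ A ∪ {0} ∧ Cardinal.mk G = Cardinal.continuum ∧
    ∀ (n : ℕ) (P : MvPolynomial (Fin n) ℝ), P ≠ 0 → MvPolynomial.coeff 0 P = 0 →
      ∀ g : Fin n → R, (∀ i, g i ∈ G) → Function.Injective g →
        MvPolynomial.aeval g P ∈ A ∧ MvPolynomial.aeval g P ≠ 0

/-- Number of squares in a window. -/
lemma aux_count (j n : ℕ) :
    ((Finset.range n).filter (fun i => IsSquare (j + i))).card ≤ Nat.sqrt n + 2 := by
  have : ((Finset.range n).filter (fun i => IsSquare (j + i))).card ≤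
      (Finset.Icc (Nat.sqrt j) (Nat.sqrt j + 1 + Nat.sqrt n)).card := by
    apply Finset.card_le_card_of_injOn (fun i => Nat.sqrt (j + i))
    · intro i hi
      simp only [Finset.coe_filter, Finset.mem_range, Set.mem_ofPred_eq] at hi
      obtain ⟨hi, k, hk⟩ := hi
      simp only [Finset.coe_Icc, Set.mem_Icc]
      refine ⟨Nat.sqrt_le_sqrt (by omega), ?_⟩
      rw [hk, Nat.sqrt_eq]
      by_contra! h
      obtain ⟨d, rfl⟩ := Nat.exists_eq_add_of_lt h
      have h1 := Nat.lt_succ_sqrt j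
      have h2 := Nat.lt_succ_sqrt n
      simp only [Nat.succ_eq_add_one] at h1 h2
      nlinarith
    · intro a ha b hb hab
      simp only [Finset.coe_filter, Finset.mem_range, Set.mem_ofPred_eq] at ha hb
      obtain ⟨_, k, hk⟩ := ha
      obtain ⟨_, l, hl⟩ := hb
      simp only [hk, hl, Nat.sqrt_eq] at hab
      subst hab
      omega
  simp only [Nat.card_Icc] at this
  omega

lemma aux_almost (y : ℕ → ℝ) (M : ℝ) (hM : ∀ m, |y m| ≤ M) (h0 : ∀ m, ¬ IsSquare m → y m = 0) :
    AlmostConvTo y 0 := by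
  have hM0 : 0 ≤ M := (abs_nonneg _).trans (hM 0)
  have hb : ∀ n j : ℕ, |(∑ i ∈ Finset.range n, y (j + i)) / n| ≤ M * ((Real.sqrt n + 2) / n) := by
    intro n j
    rw [abs_div, Nat.abs_cast, ← mul_div_assoc]
    gcongr
    rw [← Finset.sum_filter_of_ne (p := fun i => IsSquare (j + i))
      (fun i _ h => by by_contra h'; exact h (h0 _ h'))]
    calc _ ≤ ∑ i ∈ (Finset.range n).filter (fun i => IsSquare (j + i)), |y (j + i)| :=
          Finset.abs_sum_le_sum_abs _ _
      _ ≤ ∑ i ∈ (Finset.range n).filter (fun i => IsSquare (j + i)), M :=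
          Finset.sum_le_sum (fun i _ => hM _)
      _ = M * ((Finset.range n).filter (fun i => IsSquare (j + i))).card := by
          rw [Finset.sum_const, nsmul_eq_mul, mul_comm]
      _ ≤ M * (Real.sqrt n + 2) := by
          gcongr
          have h1 : (((Finset.range n).filter (fun i => IsSquare (j + i))).card : ℝ)
            ≤ (Nat.sqrt n : ℝ) + 2 := by exact_mod_cast aux_count j n
          have := Real.nat_sqrt_le_real_sqrt (a := n)
          linarith
  have hlim : Tendsto (fun n : ℕ => M * ((Real.sqrt n + 2) / n)) atTop (nhds 0) := by
    have h1 : Tendsto (fun n : ℕ => Real.sqrt (n : ℝ)) atTop atTop :=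
      Real.tendsto_sqrt_atTop.comp tendsto_natCast_atTop_atTop
    have h2 := (tendsto_inv_atTop_zero.comp h1).add
      ((tendsto_inv_atTop_zero.comp (tendsto_natCast_atTop_atTop (R := ℝ))).const_mul 2)
    have h3 := h2.const_mul M
    simp only [mul_zero, add_zero] at h3
    refine h3.congr fun n => ?_
    simp only [Function.comp]
    rw [add_div, Real.sqrt_div_self, div_eq_mul_inv]
  rw [AlmostConvTo, Metric.tendstoUniformly_iff]
  intro ε hε
  filter_upwards [hlim.eventually (gt_mem_nhds hε)] with n hn j
  rw [dist_comm, Real.dist_0_eq_abs]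
  exact (hb n j).trans_lt hn

/-- Index type of the construction. -/
abbrev AuxC : Type := ℕ × (Σ N : ℕ, ((Fin N → Bool) → ℕ))

/-- values -/
def auxPhi (t : ℕ → Bool) (c : AuxC) : ℝ := 1 / ((c.2.2 (fun i => t i) : ℝ) + 1)

def auxE : AuxC → ℕ := (exists_injective_nat AuxC).choose

lemma auxE_inj : Function.Injective auxE := (exists_injective_nat AuxC).choose_spec

def auxS (c : AuxC) : ℕ := auxE c * auxE c

lemma auxS_inj : Function.Injective auxS := fun a b h =>
  auxE_inj (Nat.mul_self_inj.mp h)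

def auxSeq (t : ℕ → Bool) : ℕ → ℝ := Function.extend auxS (auxPhi t) 0

lemma auxSeq_apply (t : ℕ → Bool) (c : AuxC) : auxSeq t (auxS c) = auxPhi t c :=
  auxS_inj.extend_apply _ _ _

lemma auxSeq_zero (t : ℕ → Bool) (m : ℕ) (h : ¬ IsSquare m) : auxSeq t m = 0 := by
  rw [auxSeq, Function.extend_apply']
  · rfl
  · rintro ⟨c, rfl⟩
    exact h ⟨auxE c, rfl⟩

lemma auxSeq_bdd (t : ℕ → Bool) (m : ℕ) : ‖auxSeq t m‖ ≤ 1 := by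
  by_cases h : ∃ c, auxS c = m
  · obtain ⟨c, rfl⟩ := h
    rw [auxSeq_apply, auxPhi, Real.norm_of_nonneg (by positivity)]
    rw [div_le_one (by positivity)]
    have : (0:ℝ) ≤ (c.2.2 (fun i => t i) : ℝ) := by positivity
    linarith
  · rw [auxSeq, Function.extend_apply' _ _ _ h]
    simp

def auxX (t : ℕ → Bool) : LInf :=
  ⟨auxSeq t, memℓp_infty ⟨1, by rintro _ ⟨m, rfl⟩; exact auxSeq_bdd t m⟩⟩

lemma auxX_apply (t : ℕ → Bool) (m : ℕ) : auxX t m = auxSeq t m := rfl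

lemma aux_sep {n : ℕ} (t : Fin n → ℕ → Bool) (ht : Function.Injective t) (v : Fin n → ℕ) :
    ∃ (N : ℕ) (f : (Fin N → Bool) → ℕ), ∀ i, f (fun k => t i k) = v i := by
  have h : ∀ p : Fin n × Fin n, ∃ k : ℕ, p.1 ≠ p.2 → t p.1 k ≠ t p.2 k := by
    intro p
    by_cases hp : p.1 = p.2
    · exact ⟨0, fun h => (h hp).elim⟩
    · obtain ⟨k, hk⟩ := Function.ne_iff.mp (ht.ne hp)
      exact ⟨k, fun _ => hk⟩
  choose K hK using h
  have hinj : Function.Injective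
      (fun (i : Fin n) (k : Fin (Finset.univ.sup K + 1)) => t i k) := by
    intro i j hij
    by_contra hne
    refine hK (i, j) hne ?_
    exact congrFun hij ⟨K (i, j), Nat.lt_succ_of_le (Finset.le_sup (Finset.mem_univ _))⟩
  exact ⟨_, Function.extend _ v 0, fun i => hinj.extend_apply v 0 i⟩

lemma auxX_inj : Function.Injective auxX := by
  intro a b hab
  by_contra hne
  obtain ⟨N, f, hf⟩ := aux_sep ![a, b] (by
    intro i j hij
    fin_cases i <;> fin_cases j <;> simp_all [eq_comm]) ![0, 1]
  have h0 := hf 0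
  have h1 := hf 1
  simp only [Matrix.cons_val_zero, Matrix.cons_val_one] at h0 h1
  have h := congrArg (fun x : LInf => x (auxS (0, ⟨N, f⟩))) hab
  simp only [auxX_apply, auxSeq_apply, auxPhi, h0, h1] at h
  norm_num at h

lemma aux_eval {n : ℕ} (g : Fin n → LInf) (P : MvPolynomial (Fin n) ℝ) (m : ℕ) :
    (MvPolynomial.aeval g P : LInf) m = MvPolynomial.eval (fun i => g i m) P := by
  induction P using MvPolynomial.induction_on with
  | C a =>
    rw [MvPolynomial.aeval_C, MvPolynomial.eval_C, Algebra.algebraMap_eq_smul_one]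
    simp [lp.infty_coeFn_one]
  | add p q hp hq => simp [lp.coeFn_add, hp, hq]
  | mul_X p i hp => simp [lp.infty_coeFn_mul, hp]

lemma aux_main {n : ℕ} (P : MvPolynomial (Fin n) ℝ) (hP : P ≠ 0) (h0 : MvPolynomial.coeff 0 P = 0)
    (t : Fin n → ℕ → Bool) (ht : Function.Injective t) :
    MvPolynomial.aeval (fun i => auxX (t i)) P ∈
      ({x : LInf | ∃ s : ℝ, AlmostConvTo (fun n => x n) s} \
       {x : LInf | ∃ l : ℝ, Tendsto (fun n : ℕ => x n) atTop (nhds l)}) := by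
  set z : LInf := MvPolynomial.aeval (fun i => auxX (t i)) P with hz
  have hzero : ∀ m, ¬ IsSquare m → z m = 0 := by
    intro m hm
    rw [hz, aux_eval]
    have : (fun i => (auxX (t i)) m) = 0 := by
      funext i
      exact auxSeq_zero _ _ hm
    rw [this, ← h0, ← MvPolynomial.constantCoeff_eq, MvPolynomial.constantCoeff]
    simp [MvPolynomial.eval_zero, MvPolynomial.constantCoeff_eq]
  refine ⟨⟨0, aux_almost _ ‖z‖ (fun m => lp.norm_apply_le_norm ENNReal.top_ne_zero z m) hzero⟩, ?_⟩
  rintro ⟨l, hl⟩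
  -- a point where P does not vanish
  obtain ⟨v, hv⟩ : ∃ v : Fin n → ℕ,
      MvPolynomial.eval (fun i => 1 / ((v i : ℝ) + 1)) P ≠ 0 := by
    by_contra! hcon
    apply hP
    have hinf : (Set.range (fun k : ℕ => 1 / ((k : ℝ) + 1))).Infinite := by
      apply Set.infinite_range_of_injective
      intro a b hab
      simpa using hab
    apply MvPolynomial.funext_set (fun _ : Fin n => Set.range (fun k : ℕ => 1 / ((k : ℝ) + 1)))
      (fun _ => hinf)
    intro x hx
    simp only [Set.mem_pi, Set.mem_univ, Set.mem_range, true_implies] at hx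
    choose v hv using hx
    have := hcon v
    simp only [hv] at this
    simpa using this
  obtain ⟨N, f, hf⟩ := aux_sep t ht v
  have hval : ∀ j : ℕ, z (auxS (j, ⟨N, f⟩)) =
      MvPolynomial.eval (fun i => 1 / ((v i : ℝ) + 1)) P := by
    intro j
    rw [hz, aux_eval]
    simp only [auxX_apply, auxSeq_apply, auxPhi, hf]
  have hs : Tendsto (fun j : ℕ => auxS (j, ⟨N, f⟩)) atTop atTop := by
    apply Function.Injective.nat_tendsto_atTop
    intro a b hab
    simpa using auxS_inj hab
  have hl1 : MvPolynomial.eval (fun i => 1 / ((v i : ℝ) + 1)) P = l := by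
    have h := hl.comp hs
    refine tendsto_nhds_unique (tendsto_const_nhds |>.congr fun j => ?_) h
    exact (hval j).symm
  have hq : Tendsto (fun j : ℕ => (j + 1) * (j + 1) + 1) atTop atTop := by
    apply tendsto_atTop_mono (f := fun j : ℕ => j) _ tendsto_id
    intro j
    nlinarith
  have hl0 : (0 : ℝ) = l := by
    have h := hl.comp hq
    refine tendsto_nhds_unique (tendsto_const_nhds |>.congr fun j => ?_) h
    refine (hzero _ ?_).symm
    rintro ⟨r, hr⟩
    rcases Nat.lt_or_ge (j + 1) r with h | h
    · nlinarith
    · nlinarith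
  exact hv (hl1.trans hl0.symm)

/-- The family `ĉ \ c` of almost convergent, non-convergent sequences is strongly
`𝔠`-algebrable in `ℓ∞` with coordinatewise multiplication. -/
theorem stmt13 :
    StronglyContinuumAlgebrable
      ({x : LInf | ∃ s : ℝ, AlmostConvTo (fun n => x n) s} \
       {x : LInf | ∃ l : ℝ, Tendsto (fun n : ℕ => x n) atTop (nhds l)}) := by
  refine ⟨Set.range auxX, ?_, ?_, ?_⟩
  · rintro _ ⟨t, rfl⟩
    left
    have := aux_main (n := 1) (MvPolynomial.X 0) (MvPolynomial.X_ne_zero 0) (by simp) (fun _ => t)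
      (Function.injective_of_subsingleton _)
    simpa only [MvPolynomial.aeval_X] using this
  · rw [Cardinal.mk_range_eq _ auxX_inj]
    simp
  · intro n P hP h0 g hg hinj
    choose t ht using hg
    have hti : Function.Injective t := by
      intro i j hij
      apply hinj
      rw [← ht i, ← ht j, hij]
    have hgt : g = fun i => auxX (t i) := funext fun i => (ht i).symm
    have hm := aux_main P hP h0 t hti
    rw [← hgt] at hm
    refine ⟨hm, fun hzero => hm.2 ⟨0, ?_⟩⟩
    rw [hzero]
    exact tendsto_const_nhds
end
end

section
/- The family S \ ĉ (of bounded sequences whose arithmetic means converge but which are not almost convergent) is strongly 𝔠-algebrable in ℓ∞ with coordinatewise multiplication. -/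
open Filter
open scoped ENNReal

noncomputable section

/-- Codes: a depth `m` and a natural-number label for every binary word of length `m`. -/
abbrev BCode : Type := Σ m : ℕ, ((Fin m → Bool) → ℕ)

instance bcode_countable : Countable BCode := by
  unfold BCode
  infer_instance

/-- An enumeration of the codes in which each code occurs infinitely often. -/
theorem exists_enum : ∃ e : ℕ → BCode, ∀ κ : BCode, ∀ N : ℕ, ∃ k, N ≤ k ∧ e k = κ := by
  have : Nonempty (BCode × ℕ) := ⟨(⟨0, fun _ => 0⟩, 0)⟩
  obtain ⟨f, hf⟩ := exists_surjective_nat (BCode × ℕ)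
  refine ⟨fun k => (f k).1, fun κ N => ?_⟩
  have hinf : Set.Infinite {k | (f k).1 = κ} := by
    have hs : Set.range (fun i : ℕ => (κ, i)) ⊆ f '' {k | (f k).1 = κ} := by
      rintro _ ⟨i, rfl⟩
      obtain ⟨k, hk⟩ := hf (κ, i)
      exact ⟨k, by simp [hk], hk⟩
    have h1 : (Set.range (fun i : ℕ => (κ, i))).Infinite :=
      Set.infinite_range_of_injective (fun a b h => by simpa using h)
    exact Set.Infinite.of_image f (h1.mono hs)
  obtain ⟨k, hk, hN⟩ := hinf.exists_gt N
  exact ⟨k, hN.le, hk⟩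

def benum : ℕ → BCode := exists_enum.choose

theorem benum_spec (κ : BCode) (N : ℕ) : ∃ k, N ≤ k ∧ benum k = κ :=
  exists_enum.choose_spec κ N

/-- value on block `k` of the sequence attached to `t` -/
def bval (κ : BCode) (t : ℕ → Bool) : ℝ := 1 / ((κ.2 (fun i => t i) : ℝ) + 1)

def InBlock (n : ℕ) : Prop := 2 ^ Nat.log 2 n ≤ n ∧ n < 2 ^ Nat.log 2 n + Nat.log 2 n

open Classical in
def bseq (t : ℕ → Bool) (n : ℕ) : ℝ := if InBlock n then bval (benum (Nat.log 2 n)) t else 0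

theorem bseq_bound (t : ℕ → Bool) (n : ℕ) : ‖bseq t n‖ ≤ 1 := by
  unfold bseq bval
  split_ifs
  · have : (0 : ℝ) ≤ ((benum (Nat.log 2 n)).2 (fun i => t i) : ℝ) := Nat.cast_nonneg _
    rw [Real.norm_of_nonneg (by positivity), div_le_one (by positivity)]
    linarith
  · simp

def bgen (t : ℕ → Bool) : LInf :=
  ⟨bseq t, memℓp_infty ⟨1, by rintro _ ⟨n, rfl⟩; exact bseq_bound t n⟩⟩

theorem bgen_apply (t : ℕ → Bool) (n : ℕ) : bgen t n = bseq t n := rfl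

/-- evaluation of a bounded sequence at a coordinate -/
def coordHom (n : ℕ) : LInf →ₐ[ℝ] ℝ :=
  AlgHom.ofLinearMap
    { toFun := fun x => x n
      map_add' := fun _ _ => rfl
      map_smul' := fun _ _ => rfl } rfl (fun _ _ => rfl)

theorem aeval_coord {m : ℕ} (g : Fin m → LInf) (P : MvPolynomial (Fin m) ℝ) (n : ℕ) :
    (MvPolynomial.aeval g P : LInf) n = MvPolynomial.eval (fun i => g i n) P := by
  have h := MvPolynomial.map_aeval g (coordHom n : LInf →+* ℝ) P
  have h2 : (coordHom n) (MvPolynomial.aeval g P) = MvPolynomial.aeval (fun i => coordHom n (g i)) P := by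
    rw [← MvPolynomial.comp_aeval_apply]
  exact h2.trans (by rw [MvPolynomial.aeval_eq_eval]; rfl)

theorem log_block {k i : ℕ} (h : i < k) : Nat.log 2 (2 ^ k + i) = k := by
  have h2 : k < 2 ^ k := Nat.lt_two_pow_self
  apply Nat.log_eq_of_pow_le_of_lt_pow
  · omega
  · rw [pow_succ]; omega

theorem inBlock_block {k i : ℕ} (h : i < k) : InBlock (2 ^ k + i) := by
  unfold InBlock
  rw [log_block h]
  omega

open Classical in
theorem card_block (N : ℕ) :
    ((Finset.range N).filter InBlock).card ≤ (Nat.log 2 N + 1) ^ 2 := by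
  have hs : (Finset.range N).filter InBlock ⊆
      (Finset.range (Nat.log 2 N + 1) ×ˢ Finset.range (Nat.log 2 N + 1)).image
        (fun p : ℕ × ℕ => 2 ^ p.1 + p.2) := by
    intro n hn
    rw [Finset.mem_filter, Finset.mem_range] at hn
    obtain ⟨hn, h1, h2⟩ := hn
    have h3 : Nat.log 2 n ≤ Nat.log 2 N := Nat.log_mono_right hn.le
    rw [Finset.mem_image]
    refine ⟨(Nat.log 2 n, n - 2 ^ Nat.log 2 n), ?_, ?_⟩
    · simp only [Finset.mem_product, Finset.mem_range]
      omega
    · simp only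
      omega
  refine (Finset.card_le_card hs).trans (Finset.card_image_le.trans ?_)
  simp [sq]

theorem tendsto_log_two : Tendsto (fun N : ℕ => Nat.log 2 N) atTop atTop := by
  refine tendsto_atTop.2 fun b => ?_
  filter_upwards [eventually_ge_atTop (2 ^ b)] with N hN
  exact Nat.le_log_of_pow_le (by norm_num) hN

theorem tendsto_card_bound (C : ℝ) :
    Tendsto (fun N : ℕ => C * (2 * (((Nat.log 2 N + 1 : ℕ) : ℝ) ^ 2 / 2 ^ (Nat.log 2 N + 1))))
      atTop (nhds 0) := by
  have h := tendsto_pow_const_div_const_pow_of_one_lt 2 (one_lt_two (α := ℝ))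
  have h2 := (h.comp (tendsto_add_atTop_nat 1)).comp tendsto_log_two
  simpa using (h2.const_mul 2).const_mul C

theorem cesaro_zero (y : ℕ → ℝ) (C : ℝ) (hC : ∀ n, |y n| ≤ C) (h0 : ∀ n, ¬ InBlock n → y n = 0) :
    Tendsto (fun n : ℕ => (∑ i ∈ Finset.range n, y i) / n) atTop (nhds 0) := by
  classical
  have hC0 : 0 ≤ C := (abs_nonneg _).trans (hC 0)
  refine squeeze_zero_norm' ?_ (tendsto_card_bound C)
  filter_upwards [eventually_ge_atTop 1] with N hN
  have hsum : |∑ i ∈ Finset.range N, y i| ≤ ((Nat.log 2 N + 1 : ℕ) : ℝ) ^ 2 * C := by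
    rw [← Finset.sum_filter_of_ne (p := InBlock)
      (fun i _ hi => by by_contra hh; exact hi (h0 i hh))]
    refine (Finset.abs_sum_le_sum_abs _ _).trans ?_
    refine (Finset.sum_le_card_nsmul _ _ C (fun i _ => hC i)).trans ?_
    rw [nsmul_eq_mul]
    refine mul_le_mul_of_nonneg_right ?_ hC0
    exact_mod_cast card_block N
  have hpow : (2 : ℝ) ^ Nat.log 2 N ≤ N := by
    exact_mod_cast Nat.pow_log_le_self 2 (by omega)
  have hp : (0 : ℝ) < 2 ^ Nat.log 2 N := by positivity
  rw [Real.norm_eq_abs, abs_div, Nat.abs_cast]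
  calc _ ≤ (((Nat.log 2 N + 1 : ℕ) : ℝ) ^ 2 * C) / 2 ^ Nat.log 2 N := by
        exact div_le_div₀ (by positivity) hsum hp hpow
    _ = _ := by rw [pow_succ (2 : ℝ)]; field_simp

theorem exists_depth {n : ℕ} (a : Fin n → ℕ → Bool) (ha : Function.Injective a) :
    ∃ m : ℕ, Function.Injective (fun (i : Fin n) (j : Fin m) => a i j) := by
  have h : ∀ p : Fin n × Fin n, ∃ d : ℕ, p.1 ≠ p.2 → a p.1 d ≠ a p.2 d := by
    intro p
    by_cases hp : p.1 = p.2
    · exact ⟨0, fun h => absurd hp h⟩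
    · obtain ⟨d, hd⟩ := Function.ne_iff.1 (ha.ne hp)
      exact ⟨d, fun _ => hd⟩
  choose d hd using h
  refine ⟨Finset.univ.sup d + 1, fun i j hij => ?_⟩
  by_contra hne
  refine hd (i, j) hne ?_
  have hle : d (i, j) ≤ Finset.univ.sup d := Finset.le_sup (Finset.mem_univ _)
  exact congrFun hij ⟨d (i, j), by omega⟩

theorem exists_code {n : ℕ} (a : Fin n → ℕ → Bool) (ha : Function.Injective a) (c : Fin n → ℕ) :
    ∃ κ : BCode, ∀ i, bval κ (a i) = 1 / ((c i : ℝ) + 1) := by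
  obtain ⟨m, hm⟩ := exists_depth a ha
  refine ⟨⟨m, Function.extend (fun (i : Fin n) (j : Fin m) => a i j) c (fun _ => 0)⟩, fun i => ?_⟩
  have := hm.extend_apply c (fun _ => 0) i
  simp only [bval]
  rw [this]

theorem exists_point {n : ℕ} (P : MvPolynomial (Fin n) ℝ) (hP : P ≠ 0) :
    ∃ c : Fin n → ℕ, MvPolynomial.eval (fun i => 1 / ((c i : ℝ) + 1)) P ≠ 0 := by
  by_contra! h
  apply hP
  refine MvPolynomial.funext_set (fun _ => Set.range (fun k : ℕ => 1 / ((k : ℝ) + 1))) ?_ ?_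
  · intro i
    refine Set.infinite_range_of_injective fun a b hab => ?_
    simpa using hab
  · intro x hx
    have hx' : ∀ i, ∃ k : ℕ, 1 / ((k : ℝ) + 1) = x i := fun i => hx i (Set.mem_univ i)
    choose c hc using hx'
    have := h c
    simp only [hc] at this
    simpa using this

theorem main_lemma {n : ℕ} (P : MvPolynomial (Fin n) ℝ) (hP : P ≠ 0)
    (hc : MvPolynomial.coeff 0 P = 0) (a : Fin n → ℕ → Bool) (ha : Function.Injective a) :
    (MvPolynomial.aeval (fun i => bgen (a i)) P : LInf) ∈
      ({x : LInf | ∃ l : ℝ,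
          Tendsto (fun n : ℕ => (∑ i ∈ Finset.range n, x i) / n) atTop (nhds l)} \
       {x : LInf | ∃ s : ℝ, AlmostConvTo (fun n => x n) s}) ∧
      (MvPolynomial.aeval (fun i => bgen (a i)) P : LInf) ≠ 0 := by
  set y : LInf := MvPolynomial.aeval (fun i => bgen (a i)) P with hy
  have hyn : ∀ k, y k = MvPolynomial.eval (fun i => bseq (a i) k) P := fun k => aeval_coord _ P k
  obtain ⟨c, hcP⟩ := exists_point P hP
  obtain ⟨κ, hκ⟩ := exists_code a ha c
  set w := MvPolynomial.eval (fun i => 1 / ((c i : ℝ) + 1)) P with hw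
  have hblock : ∀ k i, benum k = κ → i < k → y (2 ^ k + i) = w := by
    intro k i hk hi
    rw [hyn, hw]
    congr 2
    funext l
    simp only [bseq]
    rw [if_pos (inBlock_block hi), log_block hi, hk, hκ]
  have hces : Tendsto (fun n : ℕ => (∑ i ∈ Finset.range n, y i) / n) atTop (nhds 0) := by
    refine cesaro_zero (fun k => y k) ‖y‖ (fun k => lp.norm_apply_le_norm (by simp) y k) ?_
    intro k hk
    have h0 : (fun i => bseq (a i) k) = 0 := by
      funext i
      simp [bseq, hk]
    simp only [hyn, h0]
    rw [MvPolynomial.eval_zero, ← hc]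
    rfl
  refine ⟨⟨⟨0, hces⟩, ?_⟩, ?_⟩
  · rintro ⟨s, hs⟩
    have hs0 : s = 0 := by
      have h1 := hs.tendsto_at 0
      simp only [zero_add] at h1
      exact tendsto_nhds_unique h1 hces
    subst hs0
    have h2 := (Metric.tendstoUniformly_iff.1 hs) |w| (abs_pos.2 hcP)
    obtain ⟨N, hN1, hN⟩ := ((eventually_ge_atTop 1).and h2).exists
    obtain ⟨k, hk, hkκ⟩ := benum_spec κ N
    have h3 := hN (2 ^ k)
    have h4 : ∑ i ∈ Finset.range N, y (2 ^ k + i) = N * w := by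
      rw [Finset.sum_congr rfl (fun i hi => hblock k i hkκ
        (lt_of_lt_of_le (Finset.mem_range.1 hi) hk))]
      simp
    have hN0 : (N : ℝ) ≠ 0 := by
      have : N ≠ 0 := by omega
      exact_mod_cast this
    rw [h4, mul_div_cancel_left₀ _ hN0, dist_zero_left, Real.norm_eq_abs] at h3
    exact lt_irrefl _ h3
  · intro h0
    obtain ⟨k, hk, hkκ⟩ := benum_spec κ 1
    have := hblock k 0 hkκ (by omega)
    rw [h0] at this
    exact hcP this.symm

theorem bgen_injective : Function.Injective bgen := by
  intro s t hst
  by_contra hne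
  have hcast : (MvPolynomial.X 0 - MvPolynomial.X 1 : MvPolynomial (Fin 2) ℝ) ≠ 0 := by
    intro h
    have := MvPolynomial.X_injective (R := ℝ) (sub_eq_zero.1 h)
    simp at this
  refine (main_lemma (MvPolynomial.X 0 - MvPolynomial.X 1) hcast (by simp) ![s, t] ?_).2 ?_
  · intro i j
    fin_cases i <;> fin_cases j <;> simp [hne, Ne.symm hne]
  · simp [hst]

/-- The family `S \ ĉ` of bounded sequences with convergent arithmetic means which are not
almost convergent is strongly `𝔠`-algebrable in `ℓ∞`. -/
theorem stmt14 :
    StronglyContinuumAlgebrable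
      ({x : LInf | ∃ l : ℝ,
          Tendsto (fun n : ℕ => (∑ i ∈ Finset.range n, x i) / n) atTop (nhds l)} \
       {x : LInf | ∃ s : ℝ, AlmostConvTo (fun n => x n) s}) := by
  refine ⟨Set.range bgen, ?_, ?_, ?_⟩
  · rintro _ ⟨t, rfl⟩
    left
    have h := (main_lemma (MvPolynomial.X 0 : MvPolynomial (Fin 1) ℝ) (MvPolynomial.X_ne_zero 0)
      (by simp) (fun _ => t) (fun i j _ => Subsingleton.elim i j)).1
    rwa [MvPolynomial.aeval_X] at h
  · rw [Cardinal.mk_range_eq _ bgen_injective]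
    simp
  · intro n P hP hc g hg hinj
    choose a ha using hg
    obtain rfl : (fun i => bgen (a i)) = g := funext ha
    exact main_lemma P hP hc a (fun i j hij => hinj (congrArg bgen hij))
end
end

section
/- The set of sequences x ∈ X that are almost convergent (to some s ∈ ℝ) has μ-measure 0. -/
open Filter MeasureTheory
open scoped ENNReal

noncomputable section

/-- The uniform (Lebesgue) probability measure on `(-1/2, 1/2)`. -/
def unifHalf : Measure ℝ := volume.restrict (Set.Ioo (-(1 : ℝ)/2) (1/2))

/-- `X = (-1/2, 1/2)^ℕ`, as a subset of `ℝ^ℕ`. -/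
def cubeX : Set (ℕ → ℝ) := {x | ∀ i : ℕ, x i ∈ Set.Ioo (-(1 : ℝ)/2) (1/2)}

open ProbabilityTheory in
theorem ae_block (μ : Measure (ℕ → ℝ))
    (hμ : ∀ (s : Finset ℕ) (t : ℕ → Set ℝ), (∀ i, MeasurableSet (t i)) →
      μ {x : ℕ → ℝ | ∀ i ∈ s, x i ∈ t i} = ∏ i ∈ s, unifHalf (t i))
    (T : Set ℝ) (hT : MeasurableSet T) (h0 : unifHalf T ≠ 0) (n : ℕ) :
    ∀ᵐ x ∂μ, ∃ j : ℕ, ∀ i < n, x (j + i) ∈ T := by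
  have hp : IsProbabilityMeasure μ := ⟨by
    have := hμ ∅ (fun _ => T) (fun _ => hT)
    simpa using this⟩
  let E : ℕ → Set (ℕ → ℝ) := fun k => {x | ∀ i ∈ Finset.Ico (k * n) (k * n + n), x i ∈ T}
  have hE : ∀ k, μ (E k) = unifHalf T ^ n := by
    intro k
    have := hμ (Finset.Ico (k * n) (k * n + n)) (fun _ => T) (fun _ => hT)
    simpa [E] using this
  have hEm : ∀ k, MeasurableSet (E k) := by
    intro k
    have : E k = ⋂ i ∈ Finset.Ico (k * n) (k * n + n), (fun x : ℕ → ℝ => x i) ⁻¹' T := by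
      ext x; simp [E]
    rw [this]
    exact Finset.measurableSet_biInter _ fun i _ => measurable_pi_apply i hT
  have hind : iIndepSet E μ := by
    rw [iIndepSet_iff_meas_biInter hEm]
    intro s
    have h1 : (⋂ i ∈ s, E i) =
        {x | ∀ i ∈ s.biUnion (fun k => Finset.Ico (k * n) (k * n + n)), x i ∈ T} := by
      ext x
      simp only [Set.mem_iInter, Set.mem_setOf_eq, Finset.mem_biUnion, E]
      constructor
      · rintro h i ⟨k, hk, hi⟩
        exact h k hk i hi
      · intro h k hk i hi
        exact h i ⟨k, hk, hi⟩
    rw [h1, hμ _ (fun _ => T) (fun _ => hT), Finset.prod_biUnion]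
    · refine Finset.prod_congr rfl fun k _ => ?_
      rw [hE]; simp
    · intro a _ b _ hab
      have key : ∀ a b i : ℕ, a < b → i < a * n + n → b * n ≤ i → False := by
        intro a b i hab h1 h2
        have : (a + 1) * n ≤ b * n := Nat.mul_le_mul_right n hab
        rw [add_mul] at this
        omega
      refine Finset.disjoint_left.2 fun i hi hj => ?_
      rw [Finset.mem_Ico] at hi hj
      rcases lt_or_gt_of_ne hab with h | h
      · exact key a b i h hi.2 hj.1
      · exact key b a i h hj.2 hi.1
  have hlim := measure_limsup_eq_one hEm hind (by
    simp only [hE]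
    exact ENNReal.tsum_const_eq_top_of_ne_zero (pow_ne_zero n h0))
  have hae : ∀ᵐ x ∂μ, x ∈ limsup E atTop := by
    rw [← mem_ae_iff_prob_eq_one (MeasurableSet.measurableSet_limsup hEm)] at hlim
    exact hlim
  filter_upwards [hae] with x hx
  rw [Filter.mem_limsup_iff_frequently_mem] at hx
  obtain ⟨k, hk⟩ := hx.exists
  exact ⟨k * n, fun i hi => hk _ (by simp [hi])⟩

/-- If `μ` is the product over `ℕ` of the uniform measure on `(-1/2, 1/2)` (characterized
by its values on measurable cylinder sets), then the set of almost convergent `x ∈ X`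
has `μ`-measure `0`. -/
theorem stmt17 (μ : Measure (ℕ → ℝ))
    (hμ : ∀ (s : Finset ℕ) (t : ℕ → Set ℝ), (∀ i, MeasurableSet (t i)) →
      μ {x : ℕ → ℝ | ∀ i ∈ s, x i ∈ t i} = ∏ i ∈ s, unifHalf (t i)) :
    μ ({x : ℕ → ℝ | ∃ s : ℝ, AlmostConvTo x s} ∩ cubeX) = 0 := by
  have hU : ∀ᵐ x ∂μ, ∀ n : ℕ, ∃ j : ℕ, ∀ i < n, x (j + i) ∈ Set.Ioi (1/4 : ℝ) := by
    refine ae_all_iff.2 fun n => ae_block μ hμ _ measurableSet_Ioi ?_ n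
    rw [unifHalf, Measure.restrict_apply measurableSet_Ioi]
    refine ((measure_mono (?_ : Set.Ioo (1/4 : ℝ) (1/2) ⊆ _)).trans_lt' ?_).ne'
    · intro y hy
      exact ⟨hy.1, by linarith [hy.1], hy.2⟩
    · rw [Real.volume_Ioo]; norm_num
  have hL : ∀ᵐ x ∂μ, ∀ n : ℕ, ∃ j : ℕ, ∀ i < n, x (j + i) ∈ Set.Iio (-(1/4) : ℝ) := by
    refine ae_all_iff.2 fun n => ae_block μ hμ _ measurableSet_Iio ?_ n
    rw [unifHalf, Measure.restrict_apply measurableSet_Iio]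
    refine ((measure_mono (?_ : Set.Ioo (-(1/2) : ℝ) (-(1/4)) ⊆ _)).trans_lt' ?_).ne'
    · intro y hy
      exact ⟨hy.2, by linarith [hy.1], by linarith [hy.2]⟩
    · rw [Real.volume_Ioo]; norm_num
  have hmain : ∀ᵐ x ∂μ, x ∉ ({x : ℕ → ℝ | ∃ s : ℝ, AlmostConvTo x s} ∩ cubeX) := by
    filter_upwards [hU, hL] with x hxU hxL
    rintro ⟨⟨s, hs⟩, -⟩
    have h1 := Metric.tendstoUniformly_iff.1 hs (1/4) (by norm_num)
    obtain ⟨n, hn, hn1⟩ := (h1.and (eventually_ge_atTop 1)).exists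
    have hnp : (0 : ℝ) < n := by exact_mod_cast hn1
    obtain ⟨a, ha⟩ := hxU n
    obtain ⟨b, hb⟩ := hxL n
    have hA := hn a
    have hB := hn b
    have hA' : (1/4 : ℝ) ≤ (∑ i ∈ Finset.range n, x (a + i)) / n := by
      rw [le_div_iff₀ hnp]
      have := Finset.card_nsmul_le_sum (Finset.range n) (fun i => x (a + i)) (1/4)
        (fun i hi => (ha i (Finset.mem_range.1 hi)).le)
      rw [Finset.card_range, nsmul_eq_mul] at this
      linarith
    have hB' : (∑ i ∈ Finset.range n, x (b + i)) / n ≤ (-(1/4) : ℝ) := by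
      rw [div_le_iff₀ hnp]
      have := Finset.sum_le_card_nsmul (Finset.range n) (fun i => x (b + i)) (-(1/4))
        (fun i hi => (hb i (Finset.mem_range.1 hi)).le)
      rw [Finset.card_range, nsmul_eq_mul] at this
      linarith
    rw [Real.dist_eq, abs_lt] at hA hB
    linarith [hA.1, hB.2]
  exact measure_eq_zero_iff_ae_notMem.2 hmain
end
end

section
/- The set of sequences x ∈ X whose arithmetic means (x₁ + ⋯ + xₙ)/n converge (to some limit) has μ-measure 1, while each of the following sets has μ-measure 0: the sequences in X converging to 0, the convergent sequences in X, and the sequences in X almost convergent to 0. -/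
open Filter MeasureTheory
open scoped ENNReal

noncomputable section

open ProbabilityTheory in
theorem blocks_aux (μ : Measure (ℕ → ℝ)) [IsProbabilityMeasure μ]
    (hμ : ∀ (s : Finset ℕ) (t : ℕ → Set ℝ), (∀ i, MeasurableSet (t i)) →
      μ {x : ℕ → ℝ | ∀ i ∈ s, x i ∈ t i} = ∏ i ∈ s, unifHalf (t i))
    (t : Set ℝ) (ht : MeasurableSet t) (h0 : unifHalf t ≠ 0) (N : ℕ) :
    ∀ᵐ x ∂μ, ∃ᶠ k in atTop, ∀ i < N, x (k * N + i) ∈ t := by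
  classical
  let B : ℕ → Finset ℕ := fun k => (Finset.range N).image (fun i => k * N + i)
  let E : ℕ → Set (ℕ → ℝ) := fun k => {x | ∀ i ∈ B k, x i ∈ t}
  have hcard : ∀ k, (B k).card = N := by
    intro k
    rw [Finset.card_image_of_injective _ (add_right_injective _), Finset.card_range]
  have hE : ∀ k, μ (E k) = unifHalf t ^ N := by
    intro k
    rw [hμ (B k) (fun _ => t) (fun _ => ht), Finset.prod_const, hcard]
  have hEm : ∀ k, MeasurableSet (E k) := by
    intro k
    have : E k = ⋂ i ∈ B k, (fun x : ℕ → ℝ => x i) ⁻¹' t := by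
      ext x; simp [E]
    rw [this]
    exact Finset.measurableSet_biInter _ (fun i _ => measurable_pi_apply i ht)
  have hdis : ∀ k l, k ≠ l → Disjoint (B k) (B l) := by
    intro k l hkl
    rw [Finset.disjoint_left]
    intro a ha hb
    simp only [B, Finset.mem_image, Finset.mem_range] at ha hb
    obtain ⟨i, hi, rfl⟩ := ha
    obtain ⟨j, hj, h⟩ := hb
    apply hkl
    have h1 : (k * N + i) / N = k := by
      rw [mul_comm, Nat.mul_add_div (by omega), Nat.div_eq_of_lt hi, add_zero]
    have h2 : (l * N + j) / N = l := by
      rw [mul_comm, Nat.mul_add_div (by omega), Nat.div_eq_of_lt hj, add_zero]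
    rw [← h1, ← h2, h]
  have hind : iIndepSet E μ := by
    rw [iIndepSet_iff_meas_biInter hEm]
    intro S
    have : (⋂ i ∈ S, E i) = {x : ℕ → ℝ | ∀ i ∈ S.biUnion B, x i ∈ t} := by
      ext x
      simp only [E, Set.mem_iInter, Set.mem_setOf_eq, Finset.mem_biUnion]
      constructor
      · rintro h i ⟨k, hk, hi⟩
        exact h k hk i hi
      · intro h k hk i hi
        exact h i ⟨k, hk, hi⟩
    rw [this, hμ (S.biUnion B) (fun _ => t) (fun _ => ht),
      Finset.prod_biUnion (fun k _ l _ hkl => hdis k l hkl)]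
    refine Finset.prod_congr rfl (fun k _ => ?_)
    rw [hE, Finset.prod_const, hcard]
  have hlim := measure_limsup_eq_one hEm hind (by
    simp only [hE]
    exact ENNReal.tsum_const_eq_top_of_ne_zero (pow_ne_zero _ h0))
  have hae : ∀ᵐ x ∂μ, x ∈ limsup E atTop := by
    rw [← prob_compl_eq_zero_iff (MeasurableSet.measurableSet_limsup hEm)] at hlim
    exact hlim
  filter_upwards [hae] with x hx
  rw [Filter.mem_limsup_iff_frequently_mem] at hx
  refine hx.mono (fun k hk i hi => hk _ ?_)
  exact Finset.mem_image_of_mem _ (Finset.mem_range.2 hi)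


/-- If `μ` is the product over `ℕ` of the uniform measure on `(-1/2, 1/2)` (characterized
by its values on measurable cylinder sets), then `μ(S ∩ X) = 1`, while
`μ(c₀ ∩ X) = μ(c ∩ X) = μ(ĉ₀ ∩ X) = 0`. -/
theorem stmt18 (μ : Measure (ℕ → ℝ))
    (hμ : ∀ (s : Finset ℕ) (t : ℕ → Set ℝ), (∀ i, MeasurableSet (t i)) →
      μ {x : ℕ → ℝ | ∀ i ∈ s, x i ∈ t i} = ∏ i ∈ s, unifHalf (t i)) :
    μ ({x : ℕ → ℝ | ∃ l : ℝ,
        Tendsto (fun n : ℕ => (∑ i ∈ Finset.range n, x i) / n) atTop (nhds l)} ∩ cubeX)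
      = 1 ∧
    μ ({x : ℕ → ℝ | Tendsto x atTop (nhds 0)} ∩ cubeX) = 0 ∧
    μ ({x : ℕ → ℝ | ∃ l : ℝ, Tendsto x atTop (nhds l)} ∩ cubeX) = 0 ∧
    μ ({x : ℕ → ℝ | AlmostConvTo x 0} ∩ cubeX) = 0 := by
  have hun : unifHalf Set.univ = 1 := by
    simp [unifHalf]; norm_num
  have hprob : IsProbabilityMeasure μ := by
    constructor
    have := hμ ∅ (fun _ => Set.univ) (fun _ => MeasurableSet.univ)
    simpa using this
  have hmap : ∀ i, μ.map (fun x : ℕ → ℝ => x i) = unifHalf := by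
    intro i
    ext s hs
    rw [Measure.map_apply (measurable_pi_apply i) hs]
    have := hμ {i} (fun _ => s) (fun _ => hs)
    simp only [Finset.mem_singleton, forall_eq, Finset.prod_singleton] at this
    exact this
  have hcube : ∀ᵐ x ∂μ, x ∈ cubeX := by
    simp only [cubeX, Set.mem_setOf_eq]
    rw [ae_all_iff]
    intro i
    have h : ∀ᵐ y ∂(μ.map (fun x : ℕ → ℝ => x i)), y ∈ Set.Ioo (-(1 : ℝ)/2) (1/2) := by
      rw [hmap i]
      exact ae_restrict_mem measurableSet_Ioo
    exact ae_of_ae_map (measurable_pi_apply i).aemeasurable h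
  have hpos : unifHalf (Set.Ioo (1/4) (1/2)) ≠ 0 := by
    rw [unifHalf, Measure.restrict_apply measurableSet_Ioo, Set.Ioo_inter_Ioo]
    norm_num
  have hneg : unifHalf (Set.Ioo (-(1/2)) (-(1/4))) ≠ 0 := by
    rw [unifHalf, Measure.restrict_apply measurableSet_Ioo, Set.Ioo_inter_Ioo]
    norm_num
  have hP := fun N => blocks_aux μ hμ _ measurableSet_Ioo hpos N
  have hN := fun N => blocks_aux μ hμ _ measurableSet_Ioo hneg N
  have hconv : μ ({x : ℕ → ℝ | ∃ l : ℝ, Tendsto x atTop (nhds l)} ∩ cubeX) = 0 := by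
    refine measure_mono_null Set.inter_subset_left ?_
    have : ∀ᵐ x ∂μ, ¬ ∃ l : ℝ, Tendsto x atTop (nhds l) := by
      filter_upwards [hP 1, hN 1] with x h1 h2
      rintro ⟨l, hl⟩
      have a1 : (1/4 : ℝ) ≤ l := by
        by_contra! h
        refine h1 ((hl.eventually (gt_mem_nhds h)).mono fun k hk hk' => ?_)
        have := (hk' 0 one_pos).1
        simp at this hk
        linarith
      have a2 : l ≤ (-(1/4) : ℝ) := by
        by_contra! h
        refine h2 ((hl.eventually (lt_mem_nhds h)).mono fun k hk hk' => ?_)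
        have := (hk' 0 one_pos).2
        simp at this hk
        linarith
      linarith
    simpa [ae_iff] using this
  refine ⟨?_, ?_, hconv, ?_⟩
  · have hsl := ProbabilityTheory.strong_law_ae_real (μ := μ) (fun i (x : ℕ → ℝ) => x i) ?_ ?_ ?_
    · rw [← measure_univ (μ := μ)]
      apply measure_congr
      rw [eventuallyEq_univ]
      filter_upwards [hsl, hcube] with x h1 h2
      exact ⟨⟨_, h1⟩, h2⟩
    · refine Integrable.of_bound (measurable_pi_apply 0).aestronglyMeasurable (1/2) ?_
      filter_upwards [hcube] with x hx
      have := hx 0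
      rw [Real.norm_eq_abs, abs_le]
      constructor <;> linarith [this.1, this.2]
    · have hi : ProbabilityTheory.iIndepFun (fun i (x : ℕ → ℝ) => x i) μ := by
        rw [ProbabilityTheory.iIndepFun_iff_measure_inter_preimage_eq_mul]
        classical
        intro S sets hs
        have e := hμ S (fun i => if i ∈ S then sets i else Set.univ) (by
          intro i
          by_cases h : i ∈ S
          · simpa [h] using hs i h
          · simp [h])
        have e1 : (⋂ i ∈ S, (fun x : ℕ → ℝ => x i) ⁻¹' sets i) =
            {x : ℕ → ℝ | ∀ i ∈ S, x i ∈ (if i ∈ S then sets i else Set.univ)} := by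
          ext x
          simp only [Set.mem_iInter, Set.mem_preimage, Set.mem_setOf_eq]
          refine forall₂_congr fun i hi => ?_
          simp [hi]
        rw [e1, e]
        refine Finset.prod_congr rfl fun i hi => ?_
        rw [← hmap i, if_pos hi, Measure.map_apply (measurable_pi_apply i) (hs i hi)]
      intro i j hij
      exact hi.indepFun hij
    · intro i
      exact ⟨(measurable_pi_apply i).aemeasurable, (measurable_pi_apply 0).aemeasurable,
        by rw [hmap, hmap]⟩
  · refine measure_mono_null ?_ hconv
    rintro x ⟨h1, h2⟩
    exact ⟨⟨0, h1⟩, h2⟩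
  · refine measure_mono_null Set.inter_subset_left ?_
    have : ∀ᵐ x ∂μ, ¬ AlmostConvTo x 0 := by
      filter_upwards [ae_all_iff.2 hP] with x hx h
      rw [AlmostConvTo, Metric.tendstoUniformly_iff] at h
      obtain ⟨n, hn, hn1⟩ := ((h (1/4) (by norm_num)).and (eventually_ge_atTop 1)).exists
      obtain ⟨k, hk⟩ := (hx n).exists
      have h3 := hn (k * n)
      have hn0 : (0 : ℝ) < n := by exact_mod_cast hn1
      have h4 : (n : ℝ) * (1/4) ≤ ∑ i ∈ Finset.range n, x (k * n + i) := by
        have := Finset.card_nsmul_le_sum (Finset.range n) (fun i => x (k * n + i)) (1/4)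
          (fun i hi => (hk i (Finset.mem_range.1 hi)).1.le)
        simpa using this
      have h5 : (1/4 : ℝ) ≤ (∑ i ∈ Finset.range n, x (k * n + i)) / n := by
        rw [le_div_iff₀ hn0]; linarith
      rw [Real.dist_eq, zero_sub, abs_neg] at h3
      linarith [le_abs_self ((∑ i ∈ Finset.range n, x (k * n + i)) / n)]
    simpa [ae_iff] using this
end
end
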